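/- arXiv:2407.06588 — 2 statements merged into one kernel-verified Lean document; each statement's English description precedes it below -/
import Mathlib

section
/- Let d ≥ 0 be an integer, let D₁ and D₂ be compact topological spaces equipped with homeomorphisms φᵢ : Dᵈ → Dᵢ (i = 1,2), and let h : D₁ → D₂ be a continuous d-nontrivial map. Then h is surjective. -/
open CategoryTheory

/-- The singular chain complex functor with `ℤ` coefficients. -/
noncomputable def singularChains : TopCat.{0} ⥤ ChainComplex (ModuleCat.{0} ℤ) ℕ :=
  TopCat.toSSet ⋙ ((SimplicialObject.whiskering _ _).obj (ModuleCat.free ℤ)) ⋙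
    AlgebraicTopology.alternatingFaceMapComplex (ModuleCat ℤ)

/-- Singular homology with `ℤ` coefficients as a functor. -/
noncomputable def SH (n : ℕ) : TopCat.{0} ⥤ ModuleCat.{0} ℤ :=
  singularChains ⋙ HomologicalComplex.homologyFunctor _ _ n

/-- The map on singular homology induced by a continuous map. -/
noncomputable def SHmap (n : ℕ) {X Y : Type} [TopologicalSpace X] [TopologicalSpace Y]
    (f : C(X, Y)) : (SH n).obj (TopCat.of X) ⟶ (SH n).obj (TopCat.of Y) :=
  (SH n).map (X := TopCat.of X) (Y := TopCat.of Y) (TopCat.ofHom f)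

/-- Reduced singular homology in degree `n`, i.e. the kernel (here, as a set) of the map induced
on singular homology by the map to a one-point space.  A map `f` induces a group homomorphism
between the reduced homology groups, namely the restriction of `SHmap n f`. -/
noncomputable def reducedSH (n : ℕ) (X : Type) [TopologicalSpace X] :
    Set ((SH n).obj (TopCat.of X)) :=
  {x | SHmap n (ContinuousMap.const X (PUnit.unit : PUnit.{1})) x = 0}

/-- The homomorphism induced by `f` between reduced singular homology groups in degree `n`
is nonzero.  (The induced map automatically sends reduced homology into reduced homology, so
this says exactly that the restriction of `SHmap n f` to the reduced homology is nonzero.) -/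
noncomputable def SHmapNontrivial (n : ℕ) {X Y : Type} [TopologicalSpace X]
    [TopologicalSpace Y] (f : C(X, Y)) : Prop :=
  ∃ x ∈ reducedSH n X, SHmap n f x ≠ 0

/-- The restriction of a continuous map to a continuous map between subspaces. -/
def restrictCM {X Y : Type} [TopologicalSpace X] [TopologicalSpace Y] (f : C(X, Y))
    {s : Set X} {t : Set Y} (h : Set.MapsTo f s t) : C(s, t) :=
  ⟨h.restrict f s t, f.continuous.restrict h⟩

/-- The closed unit ball in `ℝᵈ`. -/
abbrev unitBall (d : ℕ) : Set (EuclideanSpace ℝ (Fin d)) := Metric.closedBall 0 1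

/-- A structure of a `d`-dimensional closed ball on a topological space `D`:
a homeomorphism from the closed unit ball of `ℝᵈ` to `D`. -/
structure BallStructure (d : ℕ) (D : Type) [TopologicalSpace D] where
  φ : unitBall d ≃ₜ D

/-- The boundary sphere of a space with a `d`-ball structure. -/
def BallStructure.boundary {d : ℕ} {D : Type} [TopologicalSpace D]
    (B : BallStructure d D) : Set D :=
  B.φ '' {x : unitBall d | ‖(x : EuclideanSpace ℝ (Fin d))‖ = 1}

/-- A continuous map between spaces with `d`-ball structures is `d`-nontrivial if either `d = 0`,
or `d > 0`, `h` maps the boundary into the boundary, and the induced homomorphism between the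
reduced singular homology groups (with `ℤ` coefficients) of the boundaries in degree `d - 1`
is nonzero. -/
noncomputable def DNontrivial (d : ℕ) {D₁ D₂ : Type} [TopologicalSpace D₁] [TopologicalSpace D₂]
    (B₁ : BallStructure d D₁) (B₂ : BallStructure d D₂) (h : C(D₁, D₂)) : Prop :=
  d = 0 ∨ (0 < d ∧ ∃ hb : Set.MapsTo h B₁.boundary B₂.boundary,
    SHmapNontrivial (d - 1) (restrictCM h hb))

/-- Homotopic maps induce the same map on singular homology. -/
theorem SHmap_eq_of_homotopic (n : ℕ) {X Y : Type} [TopologicalSpace X] [TopologicalSpace Y]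
    {f g : C(X, Y)} (H : f.Homotopic g) : SHmap n f = SHmap n g := by
  obtain ⟨H⟩ := H
  let H' : TopCat.Homotopy (TopCat.ofHom f) (TopCat.ofHom g) := H
  exact (H'.toSSet.toSimplicialObjectHomotopy.whiskerRight (ModuleCat.free ℤ)).map_homology_eq n

theorem SHmap_comp (n : ℕ) {X Y Z : Type} [TopologicalSpace X] [TopologicalSpace Y]
    [TopologicalSpace Z] (g : C(Y, Z)) (f : C(X, Y)) :
    SHmap n (g.comp f) = SHmap n f ≫ SHmap n g :=
  (SH n).map_comp (TopCat.ofHom f) (TopCat.ofHom g)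

/-- A nullhomotopic map induces the zero map on reduced singular homology. -/
theorem not_SHmapNontrivial_of_nullhomotopic (n : ℕ) {X Y : Type} [TopologicalSpace X]
    [TopologicalSpace Y] {f : C(X, Y)} (hf : f.Nullhomotopic) : ¬ SHmapNontrivial n f := by
  rintro ⟨x, hx, hne⟩
  obtain ⟨y, hy⟩ := hf
  apply hne
  rw [SHmap_eq_of_homotopic n hy,
    show ContinuousMap.const X y = (ContinuousMap.const PUnit.{1} y).comp
      (ContinuousMap.const X PUnit.unit) from rfl, SHmap_comp]
  have hx' : SHmap n (ContinuousMap.const X (PUnit.unit : PUnit.{1})) x = 0 := hx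
  rw [ConcreteCategory.comp_apply, hx', map_zero]

section Normalize

variable {E : Type*} [NormedAddCommGroup E] [NormedSpace ℝ E] {X : Type*} [TopologicalSpace X]

/-- The map to the unit sphere obtained by normalizing a nowhere vanishing map. -/
noncomputable def normalizeCM (u : C(X, E)) (hu : ∀ x, u x ≠ 0) :
    C(X, Metric.sphere (0 : E) 1) where
  toFun x := ⟨‖u x‖⁻¹ • u x, by simp [norm_smul, hu x]⟩
  continuous_toFun := by
    refine Continuous.subtype_mk (Continuous.smul (Continuous.inv₀ (by fun_prop) ?_)
      (by fun_prop)) _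
    simpa using hu

/-- If a map from a contractible space `X` to a normed space avoids a point of the open unit ball,
then its restriction to any subset mapped into the unit sphere is nullhomotopic there. -/
theorem nullhomotopic_restrict_of_avoids [ContractibleSpace X] (g : C(X, E)) {y : E}
    (hy : ‖y‖ < 1) (hg : ∀ x, g x ≠ y) {s : Set X}
    (hs : Set.MapsTo g s (Metric.sphere 0 1)) :
    ContinuousMap.Nullhomotopic
      (⟨hs.restrict g s _, g.continuous.restrict hs⟩ : C(s, Metric.sphere (0 : E) 1)) := by
  let v : C(X, Metric.sphere (0 : E) 1) :=
    normalizeCM (g - ContinuousMap.const X y) fun x ↦ sub_ne_zero.2 (hg x)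
  let i : C(s, X) := ⟨Subtype.val, continuous_subtype_val⟩
  have hv : (v.comp i).Nullhomotopic :=
    ((id_nullhomotopic X).comp_right v).comp_left i
  obtain ⟨z, hz⟩ := hv
  have hnorm (x : s) : ‖g x‖ = 1 := by simpa using hs x.2
  have hne (p : unitInterval × s) : g p.2 - (p.1 : ℝ) • y ≠ 0 := by
    intro h0
    have h1 : ‖(p.1 : ℝ) • y‖ = 1 := by rw [← sub_eq_zero.1 h0, hnorm]
    rw [norm_smul, Real.norm_of_nonneg p.1.2.1] at h1
    nlinarith [p.1.2.1, p.1.2.2, norm_nonneg y]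
  refine ⟨z, ContinuousMap.Homotopic.trans ⟨?_⟩ hz⟩
  exact
    { toContinuousMap := normalizeCM
        ⟨fun p : unitInterval × s ↦ g p.2 - (p.1 : ℝ) • y, by fun_prop⟩ hne
      map_zero_left := fun x ↦ by
        ext1
        simp [normalizeCM, hnorm x]
      map_one_left := fun x ↦ by
        ext1
        simp [normalizeCM, v, i] }

end Normalize

/-- If `d ≥ 0`, `D₁`, `D₂` are compact topological spaces with `d`-ball
structures and `h : D₁ → D₂` is a continuous `d`-nontrivial map, then `h` is surjective. -/
theorem dNontrivial_surjective (d : ℕ) (D₁ D₂ : Type) [TopologicalSpace D₁] [TopologicalSpace D₂]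
    [CompactSpace D₁] [CompactSpace D₂] (B₁ : BallStructure d D₁) (B₂ : BallStructure d D₂)
    (h : C(D₁, D₂)) (hnt : DNontrivial d B₁ B₂ h) : Function.Surjective h := by
  rcases hnt with rfl | ⟨-, hb, hnt⟩
  · have : Subsingleton D₂ := B₂.φ.symm.injective.subsingleton
    exact fun y ↦ ⟨B₁.φ ⟨0, by simp⟩, Subsingleton.elim _ _⟩
  by_contra hsurj
  have : T2Space D₂ := B₂.φ.t2Space
  have : ContractibleSpace (unitBall d) :=
    (convex_closedBall 0 1).contractibleSpace ⟨0, by simp⟩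
  have : ContractibleSpace D₁ := B₁.φ.symm.contractibleSpace
  let g : C(D₁, EuclideanSpace ℝ (Fin d)) :=
    ⟨fun x ↦ (B₂.φ.symm (h x) : EuclideanSpace ℝ (Fin d)), by fun_prop⟩
  obtain ⟨y, hy, hgy⟩ : ∃ y, ‖y‖ < 1 ∧ ∀ x, g x ≠ y := by
    obtain ⟨p, hp⟩ := not_forall.1 hsurj
    have hclosed : IsClosed (Set.range g) := (isCompact_range g.continuous).isClosed
    have hpg : (B₂.φ.symm p : EuclideanSpace ℝ (Fin d)) ∈ (Set.range g)ᶜ := by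
      rintro ⟨x, hx⟩
      exact hp ⟨x, B₂.φ.symm.injective (Subtype.ext hx)⟩
    have hcl : (B₂.φ.symm p : EuclideanSpace ℝ (Fin d)) ∈ closure (Metric.ball 0 1) := by
      rw [closure_ball _ one_ne_zero]
      exact (B₂.φ.symm p).2
    obtain ⟨y, hy, hy1⟩ := mem_closure_iff.1 hcl _ hclosed.isOpen_compl hpg
    exact ⟨y, by simpa using hy1, fun x hx ↦ hy ⟨x, hx⟩⟩
  have hs : Set.MapsTo g B₁.boundary (Metric.sphere 0 1) := by
    intro x hx
    obtain ⟨w, hw, hwx⟩ := hb hx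
    simpa [g, ← hwx] using hw
  let e : C(Metric.sphere (0 : EuclideanSpace ℝ (Fin d)) 1, B₂.boundary) :=
    ⟨fun z ↦ ⟨B₂.φ ⟨z, Metric.sphere_subset_closedBall z.2⟩, _, by simp, rfl⟩, by fun_prop⟩
  have hnull := (nullhomotopic_restrict_of_avoids g hy hgy hs).comp_right e
  refine not_SHmapNontrivial_of_nullhomotopic _ ?_ hnt
  convert hnull using 1
  ext x
  simp [e, g, restrictCM]
end

section
/- Let d, e ≥ 0 be integers, let D₁, D₂ be compact topological spaces equipped with homeomorphisms from Dᵈ, and let D₃, D₄ be compact topological spaces equipped with homeomorphisms from Dᵉ. If h : D₁ → D₂ is a continuous d-nontrivial map and g : D₃ → D₄ is a continuous e-nontrivial map, then the product map h × g : D₁ × D₃ → D₂ × D₄ is (d+e)-nontrivial (with respect to the product ball structures). -/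
open CategoryTheory

/-- The chains freely generated by the `n`-tuples of points of `M`. -/
abbrev TupleChain (n : ℕ) (M : Type) : Type := (Fin n → M) →₀ ℤ

namespace TupleChain

variable {M N P : Type} {n : ℕ}

/-- The alternating sum of the faces of a tuple. -/
noncomputable def bd (n : ℕ) (M : Type) : TupleChain (n + 1) M →ₗ[ℤ] TupleChain n M :=
  Finsupp.linearCombination ℤ fun v =>
    ∑ i : Fin (n + 1), (-1 : ℤ) ^ (i : ℕ) • Finsupp.single (fun j => v (i.succAbove j)) 1

/-- The cone with apex `b`. -/
noncomputable def cone (b : M) : TupleChain n M →ₗ[ℤ] TupleChain (n + 1) M :=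
  Finsupp.lmapDomain ℤ ℤ fun v => (Fin.cons b v : Fin (n + 1) → M)

/-- Functoriality of tuple chains. -/
noncomputable def map (f : M → N) : TupleChain n M →ₗ[ℤ] TupleChain n N :=
  Finsupp.lmapDomain ℤ ℤ fun v i => f (v i)

lemma bd_single (v : Fin (n + 1) → M) : bd n M (Finsupp.single v 1) =
    ∑ i : Fin (n + 1), (-1 : ℤ) ^ (i : ℕ) • Finsupp.single (fun j => v (i.succAbove j)) 1 := by
  simp [bd]

lemma cone_single (b : M) (v : Fin n → M) :
    cone b (Finsupp.single v 1) = Finsupp.single (Fin.cons b v : Fin (n + 1) → M) 1 := by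
  simp [cone]

lemma map_single (f : M → N) (v : Fin n → M) :
    map f (Finsupp.single v 1) = Finsupp.single (fun i => f (v i)) 1 := by
  simp [map]

lemma map_map (g : N → P) (f : M → N) (c : TupleChain n M) :
    map g (map f c) = map (fun x => g (f x)) c := by
  simp only [map, Finsupp.lmapDomain_apply, ← Finsupp.mapDomain_comp]; rfl

lemma map_bd (f : M → N) (c : TupleChain (n + 1) M) : map f (bd n M c) = bd n N (map f c) := by
  suffices h : map f ∘ₗ bd n M = bd n N ∘ₗ map f from LinearMap.congr_fun h c
  ext v : 2
  simp only [LinearMap.comp_apply, Finsupp.lsingle_apply, bd_single, map_single, map_sum, map_smul]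

lemma map_cone (f : M → N) (b : M) (c : TupleChain n M) :
    map f (cone b c) = cone (f b) (map f c) := by
  suffices h : map f ∘ₗ cone b = cone (n := n) (f b) ∘ₗ map f from LinearMap.congr_fun h c
  ext v : 2
  simp only [LinearMap.comp_apply, Finsupp.lsingle_apply, map_single, cone_single]
  congr 1
  funext i
  refine Fin.cases ?_ (fun j => ?_) i <;> simp

lemma bd_cone_zero (b : M) (c : TupleChain 0 M) : bd 0 M (cone b c) = c := by
  suffices h : bd 0 M ∘ₗ cone b = LinearMap.id from LinearMap.congr_fun h c
  ext v : 2
  simp [bd_single, cone_single]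

lemma bd_cone_succ (b : M) (c : TupleChain (n + 1) M) :
    bd (n + 1) M (cone b c) = c - cone b (bd n M c) := by
  suffices h : bd (n + 1) M ∘ₗ cone b = LinearMap.id - cone b ∘ₗ bd n M from
    LinearMap.congr_fun h c
  ext v : 2
  simp only [LinearMap.comp_apply, Finsupp.lsingle_apply, cone_single, bd_single,
    Fin.sum_univ_succ (n := n + 1), LinearMap.sub_apply, LinearMap.id_apply, map_sum, map_smul]
  simp only [Fin.val_zero, pow_zero, one_smul, Fin.zero_succAbove, Fin.cons_succ, Fin.val_succ,
    pow_succ, mul_neg_one, neg_smul, Finset.sum_neg_distrib, sub_eq_add_neg]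
  congr 2
  refine Finset.sum_congr rfl fun i _ => ?_
  congr 2
  funext j
  refine Fin.cases ?_ (fun j => ?_) j <;> simp

lemma bd_bd (c : TupleChain (n + 2) M) : bd n M (bd (n + 1) M c) = 0 := by
  suffices h : bd n M ∘ₗ bd (n + 1) M = 0 from LinearMap.congr_fun h c
  clear c
  induction n with
  | zero =>
    ext v : 2
    simp only [LinearMap.comp_apply, Finsupp.lsingle_apply]
    rw [← Fin.cons_self_tail v, ← cone_single, bd_cone_succ, map_sub, bd_cone_zero]
    simp
  | succ n ih =>
    ext v : 2
    simp only [LinearMap.comp_apply, Finsupp.lsingle_apply]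
    rw [← Fin.cons_self_tail v, ← cone_single, bd_cone_succ, map_sub, bd_cone_succ,
      ← LinearMap.comp_apply (bd n M), ih]
    simp

end TupleChain

open scoped unitInterval
/-- The standard simplex with `n` vertices (of dimension `n - 1`; it is empty for `n = 0`). -/
abbrev TopSimplex (n : ℕ) : Type := stdSimplex ℝ (Fin n)

/-- The affine map from a simplex to a convex set with prescribed values on the vertices. -/
noncomputable def Convex.comb {E : Type} [AddCommGroup E] [Module ℝ E] [TopologicalSpace E]
    [ContinuousAdd E] [ContinuousSMul ℝ E] {K : Set E} (hK : Convex ℝ K) {n : ℕ} (v : Fin n → K) :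
    C(TopSimplex n, K) where
  toFun x := ⟨∑ i, x i • (v i : E),
    hK.sum_mem (fun i _ => x.2.1 i) x.2.2 (fun i _ => (v i).2)⟩
  continuous_toFun := by
    refine Continuous.subtype_mk (continuous_finsetSum _ fun i _ => ?_) _
    exact ((continuous_apply i).comp continuous_subtype_val).smul continuous_const

/-- The affine map from a simplex to a simplex with prescribed values on the vertices. -/
noncomputable abbrev simplexComb {n k : ℕ} (v : Fin n → TopSimplex k) :
    C(TopSimplex n, TopSimplex k) :=
  (convex_stdSimplex ℝ (Fin k)).comb v

/-- The affine map from a simplex to a prism with prescribed values on the vertices. -/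
noncomputable def prismComb {n k : ℕ} (v : Fin n → TopSimplex k × I) :
    C(TopSimplex n, TopSimplex k × I) :=
  (simplexComb fun i => (v i).1).prodMk ((convex_Icc (0 : ℝ) 1).comb fun i => (v i).2)

section comb

variable {E : Type} [AddCommGroup E] [Module ℝ E] [TopologicalSpace E]
  [ContinuousAdd E] [ContinuousSMul ℝ E] {K : Set E} (hK : Convex ℝ K) {n k : ℕ}

lemma Convex.comb_vertex (v : Fin n → K) (i : Fin n) :
    hK.comb v (stdSimplex.vertex i) = v i := by
  ext
  simp [Convex.comb, Pi.single_apply]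

lemma Convex.comb_comb (w : Fin k → K) (v : Fin n → TopSimplex k) (x : TopSimplex n) :
    hK.comb w (simplexComb v x) = hK.comb (fun i => hK.comb w (v i)) x := by
  apply Subtype.ext
  change ∑ j, (∑ i, x i • (v i : Fin k → ℝ)) j • (w j : E) =
    ∑ i, x i • ∑ j, (v i) j • (w j : E)
  simp only [Finset.smul_sum, Finset.sum_apply, Finset.sum_smul, smul_smul, Pi.smul_apply,
    smul_eq_mul]
  rw [Finset.sum_comm]

lemma simplexComb_vertices (x : TopSimplex n) :
    simplexComb (fun i : Fin n => stdSimplex.vertex i) x = x := by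
  apply Subtype.ext
  change ∑ i, x i • (stdSimplex.vertex i : stdSimplex ℝ (Fin n)).1 = x
  funext j
  simp [Pi.single_apply]

lemma prismComb_comb (w : Fin k → TopSimplex n × I) {m : ℕ} (v : Fin m → TopSimplex k)
    (x : TopSimplex m) :
    prismComb w (simplexComb v x) = prismComb (fun i => prismComb w (v i)) x :=
  Prod.ext (Convex.comb_comb _ _ _ _) (Convex.comb_comb _ _ _ _)

lemma comb_prismComb {m : ℕ} (w : Fin k → TopSimplex n) (v : Fin m → TopSimplex k × I)
    (x : TopSimplex m) :
    (simplexComb w (prismComb v x).1, (prismComb v x).2) =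
      prismComb (fun i => (simplexComb w (v i).1, (v i).2)) x :=
  Prod.ext (Convex.comb_comb _ _ _ _) rfl

lemma prismComb_const (v : Fin n → TopSimplex k) (t : I) (x : TopSimplex n) :
    prismComb (fun i => (v i, t)) x = (simplexComb v x, t) := by
  refine Prod.ext rfl (Subtype.ext ?_)
  change ∑ i, x i • (t : ℝ) = t
  rw [← Finset.sum_smul, stdSimplex.sum_eq_one, one_smul]

end comb

/-- The barycenter of a nonempty tuple of points of a simplex. -/
noncomputable def tupleBary {n k : ℕ} (v : Fin (n + 1) → TopSimplex k) : TopSimplex k :=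
  simplexComb v stdSimplex.barycenter

lemma comb_tupleBary {n k l : ℕ} (w : Fin k → TopSimplex l) (v : Fin (n + 1) → TopSimplex k) :
    simplexComb w (tupleBary v) = tupleBary fun i => simplexComb w (v i) :=
  Convex.comb_comb _ _ _ _

namespace TupleChain

variable {n k l : ℕ}

/-- The barycentric subdivision of affine chains in a simplex. -/
noncomputable def sd (k : ℕ) : ∀ n, TupleChain n (TopSimplex k) →ₗ[ℤ] TupleChain n (TopSimplex k)
  | 0 => LinearMap.id
  | n + 1 => Finsupp.linearCombination ℤ fun v =>
      cone (tupleBary v) (sd k n (bd n _ (Finsupp.single v 1)))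

/-- A chain homotopy, in the prism over a simplex, from the bottom inclusion to
the subdivision of the top inclusion. -/
noncomputable def sdHomotopy (k : ℕ) :
    ∀ n, TupleChain n (TopSimplex k) →ₗ[ℤ] TupleChain (n + 1) (TopSimplex k × I)
  | 0 => 0
  | n + 1 => Finsupp.linearCombination ℤ fun v =>
      cone (tupleBary v, 0) (map (fun x => (x, 1)) (sd k (n + 1) (Finsupp.single v 1))
        - map (fun x => (x, 0)) (Finsupp.single v 1)
        - sdHomotopy k n (bd n _ (Finsupp.single v 1)))

lemma sd_succ_single (v : Fin (n + 1) → TopSimplex k) : sd k (n + 1) (Finsupp.single v 1) =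
    cone (tupleBary v) (sd k n (bd n _ (Finsupp.single v 1))) := by
  simp [sd]

lemma sdHomotopy_succ_single (v : Fin (n + 1) → TopSimplex k) :
    sdHomotopy k (n + 1) (Finsupp.single v 1) =
      cone (tupleBary v, 0) (map (fun x => (x, 1)) (sd k (n + 1) (Finsupp.single v 1))
        - map (fun x => (x, 0)) (Finsupp.single v 1)
        - sdHomotopy k n (bd n _ (Finsupp.single v 1))) := by
  rw [sdHomotopy, Finsupp.linearCombination_single, one_smul]

lemma bd_sd (c : TupleChain (n + 1) (TopSimplex k)) :
    bd n _ (sd k (n + 1) c) = sd k n (bd n _ c) := by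
  suffices h : bd n _ ∘ₗ sd k (n + 1) = sd k n ∘ₗ bd n _ from LinearMap.congr_fun h c
  clear c
  induction n with
  | zero =>
    ext v : 2
    simp only [LinearMap.comp_apply, Finsupp.lsingle_apply, sd_succ_single, bd_cone_zero]
  | succ n ih =>
    ext v : 2
    simp only [LinearMap.comp_apply, Finsupp.lsingle_apply, sd_succ_single, bd_cone_succ]
    rw [← LinearMap.comp_apply (bd n _), ih, LinearMap.comp_apply,
      bd_bd, map_zero, map_zero, sub_zero]

lemma map_sd (w : Fin k → TopSimplex l) (c : TupleChain n (TopSimplex k)) :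
    map (simplexComb w) (sd k n c) = sd l n (map (simplexComb w) c) := by
  suffices h : map (simplexComb w) ∘ₗ sd k n = sd l n ∘ₗ map (simplexComb w) from
    LinearMap.congr_fun h c
  clear c
  induction n with
  | zero => rfl
  | succ n ih =>
    ext v : 2
    simp only [LinearMap.comp_apply, Finsupp.lsingle_apply, sd_succ_single, map_cone, map_single,
      comb_tupleBary]
    rw [← LinearMap.comp_apply (map _), ih, LinearMap.comp_apply,
      map_bd, map_single]

lemma bd_sdHomotopy_zero (c : TupleChain 0 (TopSimplex k)) :
    bd 0 _ (sdHomotopy k 0 c) = map (fun x => (x, 1)) (sd k 0 c) - map (fun x => (x, 0)) c := by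
  have : ∀ c : TupleChain 0 (TopSimplex k),
      map (fun x => (x, (1 : I))) c = map (fun x => (x, (0 : I))) c := by
    intro c
    rw [map, map]
    congr 2
    funext v
    exact Subsingleton.elim _ _
  simp [sdHomotopy, sd, this]

lemma bd_sdHomotopy_succ (c : TupleChain (n + 1) (TopSimplex k)) :
    bd (n + 1) _ (sdHomotopy k (n + 1) c) = map (fun x => (x, 1)) (sd k (n + 1) c)
      - map (fun x => (x, 0)) c - sdHomotopy k n (bd n _ c) := by
  suffices h : bd (n + 1) _ ∘ₗ sdHomotopy k (n + 1) =
      map (fun x => (x, 1)) ∘ₗ sd k (n + 1) - map (fun x => (x, 0))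
        - sdHomotopy k n ∘ₗ bd n _ from LinearMap.congr_fun h c
  clear c
  induction n with
  | zero =>
    ext v : 2
    simp only [LinearMap.comp_apply, LinearMap.sub_apply, Finsupp.lsingle_apply,
      sdHomotopy_succ_single, bd_cone_succ]
    simp only [sub_eq_self, map_sub, ← map_bd]
    simp only [bd_sdHomotopy_zero, bd_sd, map_sub, sub_self]
  | succ n ih =>
    ext v : 2
    simp only [LinearMap.comp_apply, LinearMap.sub_apply, Finsupp.lsingle_apply,
      sdHomotopy_succ_single, bd_cone_succ]
    have ih' := LinearMap.congr_fun ih (bd _ _ (Finsupp.single v 1))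
    simp only [LinearMap.comp_apply, LinearMap.sub_apply, bd_bd, map_zero, sub_zero] at ih'
    simp only [sub_eq_self, map_sub, ← map_bd, ih', bd_sd, sub_self, map_zero]

lemma map_sdHomotopy (w : Fin k → TopSimplex l) (c : TupleChain n (TopSimplex k)) :
    map (fun p => (simplexComb w p.1, p.2)) (sdHomotopy k n c) =
      sdHomotopy l n (map (simplexComb w) c) := by
  suffices h : map (fun p => (simplexComb w p.1, p.2)) ∘ₗ sdHomotopy k n =
      sdHomotopy l n ∘ₗ map (simplexComb w) from LinearMap.congr_fun h c
  clear c
  induction n with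
  | zero => simp [sdHomotopy]
  | succ n ih =>
    ext v : 2
    simp only [LinearMap.comp_apply, Finsupp.lsingle_apply]
    have ih' := LinearMap.congr_fun ih (bd _ _ (Finsupp.single v 1))
    simp only [LinearMap.comp_apply, map_bd] at ih'
    rw [map_single, sdHomotopy_succ_single, sdHomotopy_succ_single, map_cone, comb_tupleBary]
    simp only [map_sub, ih', map_map, ← map_single (simplexComb w), ← map_sd]

end TupleChain

/-- Singular chains, indexed by the number of vertices of the simplices: `SimplexChain 0 X` is
the augmentation group `ℤ`. -/
abbrev SimplexChain (n : ℕ) (X : Type) [TopologicalSpace X] : Type := C(TopSimplex n, X) →₀ ℤ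

namespace SimplexChain

variable {X Y Z : Type} [TopologicalSpace X] [TopologicalSpace Y] [TopologicalSpace Z] {n k : ℕ}

/-- The inclusion of a face of a simplex. -/
noncomputable def face (i : Fin (n + 1)) : C(TopSimplex n, TopSimplex (n + 1)) :=
  simplexComb fun j => stdSimplex.vertex (i.succAbove j)

/-- The (augmented) singular boundary. -/
noncomputable def bd (n : ℕ) (X : Type) [TopologicalSpace X] :
    SimplexChain (n + 1) X →ₗ[ℤ] SimplexChain n X :=
  Finsupp.linearCombination ℤ fun τ =>
    ∑ i : Fin (n + 1), (-1 : ℤ) ^ (i : ℕ) • Finsupp.single (τ.comp (face i)) 1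

/-- Functoriality of singular chains. -/
noncomputable def push (f : C(X, Y)) : SimplexChain n X →ₗ[ℤ] SimplexChain n Y :=
  Finsupp.lmapDomain ℤ ℤ fun τ => f.comp τ

/-- The singular chain obtained by restricting a singular simplex to an affine chain. -/
noncomputable def realize (τ : C(TopSimplex k, X)) :
    TupleChain n (TopSimplex k) →ₗ[ℤ] SimplexChain n X :=
  Finsupp.lmapDomain ℤ ℤ fun v => τ.comp (simplexComb v)

/-- The singular chain obtained by restricting a map on a prism to an affine chain. -/
noncomputable def realizePrism (H : C(TopSimplex k × I, X)) :
    TupleChain n (TopSimplex k × I) →ₗ[ℤ] SimplexChain n X :=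
  Finsupp.lmapDomain ℤ ℤ fun v => H.comp (prismComb v)

/-- The affine chain consisting of the whole simplex. -/
noncomputable def verts (n : ℕ) : TupleChain n (TopSimplex n) :=
  Finsupp.single (fun i => stdSimplex.vertex i) 1

lemma bd_single (τ : C(TopSimplex (n + 1), X)) : bd n X (Finsupp.single τ 1) =
    ∑ i : Fin (n + 1), (-1 : ℤ) ^ (i : ℕ) • Finsupp.single (τ.comp (face i)) 1 := by
  simp [bd]

lemma push_single (f : C(X, Y)) (τ : C(TopSimplex n, X)) :
    push f (Finsupp.single τ 1) = Finsupp.single (f.comp τ) 1 := by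
  simp [push]

lemma realize_single (τ : C(TopSimplex k, X)) (v : Fin n → TopSimplex k) :
    realize τ (Finsupp.single v 1) = Finsupp.single (τ.comp (simplexComb v)) 1 := by
  simp [realize]

lemma realizePrism_single (H : C(TopSimplex k × I, X)) (v : Fin n → TopSimplex k × I) :
    realizePrism H (Finsupp.single v 1) = Finsupp.single (H.comp (prismComb v)) 1 := by
  simp [realizePrism]

lemma realize_verts (τ : C(TopSimplex n, X)) : realize τ (verts n) = Finsupp.single τ 1 := by
  rw [verts, realize_single]
  congr 1
  ext x
  exact congrArg τ (simplexComb_vertices x)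

lemma map_verts (v : Fin n → TopSimplex k) :
    TupleChain.map (simplexComb v) (verts n) = Finsupp.single v 1 := by
  rw [verts, TupleChain.map_single]
  congr 1
  funext i
  exact Convex.comb_vertex _ _ _

lemma simplexComb_face {l : ℕ} (v : Fin (l + 1) → TopSimplex k) (i : Fin (l + 1))
    (x : TopSimplex l) :
    simplexComb v (face i x) = simplexComb (fun j => v (i.succAbove j)) x := by
  rw [face, Convex.comb_comb]
  simp only [Convex.comb_vertex]

lemma prismComb_face {l : ℕ} (v : Fin (l + 1) → TopSimplex k × I) (i : Fin (l + 1))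
    (x : TopSimplex l) :
    prismComb v (face i x) = prismComb (fun j => v (i.succAbove j)) x := by
  rw [face, prismComb_comb]
  congr 2
  funext j
  exact Prod.ext (Convex.comb_vertex _ _ _) (Convex.comb_vertex _ _ _)

lemma push_push (g : C(Y, Z)) (f : C(X, Y)) (c : SimplexChain n X) :
    push g (push f c) = push (g.comp f) c := by
  simp only [push, Finsupp.lmapDomain_apply, ← Finsupp.mapDomain_comp]; rfl

lemma push_id (c : SimplexChain n X) : push (ContinuousMap.id X) c = c :=
  Finsupp.mapDomain_id

lemma push_bd (f : C(X, Y)) (c : SimplexChain (n + 1) X) :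
    push f (bd n X c) = bd n Y (push f c) := by
  suffices h : push f ∘ₗ bd n X = bd n Y ∘ₗ push f from LinearMap.congr_fun h c
  ext τ : 2
  simp only [LinearMap.comp_apply, Finsupp.lsingle_apply, bd_single, push_single, map_sum,
    map_smul, ContinuousMap.comp_assoc]

lemma push_realize (f : C(X, Y)) (τ : C(TopSimplex k, X)) (c : TupleChain n (TopSimplex k)) :
    push f (realize τ c) = realize (f.comp τ) c := by
  simp only [push, realize, Finsupp.lmapDomain_apply, ← Finsupp.mapDomain_comp]; rfl

lemma bd_realize (τ : C(TopSimplex k, X)) (c : TupleChain (n + 1) (TopSimplex k)) :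
    bd n X (realize τ c) = realize τ (TupleChain.bd n _ c) := by
  suffices h : bd n X ∘ₗ realize τ = realize τ ∘ₗ TupleChain.bd n _ from LinearMap.congr_fun h c
  ext v : 2
  simp only [LinearMap.comp_apply, Finsupp.lsingle_apply, bd_single, realize_single, map_sum,
    map_smul, TupleChain.bd_single]
  refine Finset.sum_congr rfl fun i _ => ?_
  congr 2
  ext x
  exact congrArg τ (simplexComb_face v i x)

lemma bd_realizePrism (H : C(TopSimplex k × I, X)) (c : TupleChain (n + 1) (TopSimplex k × I)) :
    bd n X (realizePrism H c) = realizePrism H (TupleChain.bd n _ c) := by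
  suffices h : bd n X ∘ₗ realizePrism H = realizePrism H ∘ₗ TupleChain.bd n _ from
    LinearMap.congr_fun h c
  ext v : 2
  simp only [LinearMap.comp_apply, Finsupp.lsingle_apply, bd_single, realizePrism_single, map_sum,
    map_smul, TupleChain.bd_single]
  refine Finset.sum_congr rfl fun i _ => ?_
  congr 2
  ext x
  exact congrArg H (prismComb_face v i x)

lemma realize_map {l : ℕ} (τ : C(TopSimplex k, X)) (w : Fin l → TopSimplex k)
    (c : TupleChain n (TopSimplex l)) :
    realize τ (TupleChain.map (simplexComb w) c) = realize (τ.comp (simplexComb w)) c := by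
  suffices h : realize τ ∘ₗ TupleChain.map (simplexComb w) =
    realize (n := n) (τ.comp (simplexComb w)) from LinearMap.congr_fun h c
  ext v : 2
  simp only [LinearMap.comp_apply, Finsupp.lsingle_apply, realize_single, TupleChain.map_single]
  congr 1
  ext x
  exact congrArg τ (Convex.comb_comb _ _ _ _).symm

lemma realizePrism_map {l : ℕ} (H : C(TopSimplex k × I, X)) (w : Fin l → TopSimplex k)
    (c : TupleChain n (TopSimplex l × I)) :
    realizePrism H (TupleChain.map (fun p => (simplexComb w p.1, p.2)) c) =
      realizePrism (H.comp ((simplexComb w).prodMap (ContinuousMap.id I))) c := by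
  suffices h : realizePrism H ∘ₗ TupleChain.map (fun p => (simplexComb w p.1, p.2)) =
    realizePrism (n := n) (H.comp ((simplexComb w).prodMap (ContinuousMap.id I))) from
      LinearMap.congr_fun h c
  ext v : 2
  simp only [LinearMap.comp_apply, Finsupp.lsingle_apply, realizePrism_single,
    TupleChain.map_single]
  congr 1
  ext x
  exact congrArg H (comb_prismComb _ _ _).symm

/-- The inclusion of a slice of a cylinder. -/
def slice (X : Type) [TopologicalSpace X] (t : I) : C(X, X × I) :=
  (ContinuousMap.id X).prodMk (ContinuousMap.const X t)

lemma realizePrism_map_slice (H : C(TopSimplex k × I, X)) (t : I)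
    (c : TupleChain n (TopSimplex k)) :
    realizePrism H (TupleChain.map (fun x => (x, t)) c) = realize (H.comp (slice _ t)) c := by
  suffices h : realizePrism H ∘ₗ TupleChain.map (fun x => (x, t)) =
    realize (n := n) (H.comp (slice _ t)) from LinearMap.congr_fun h c
  ext v : 2
  simp only [LinearMap.comp_apply, Finsupp.lsingle_apply, realizePrism_single, realize_single,
    TupleChain.map_single]
  congr 1
  ext x
  exact congrArg H (prismComb_const _ _ _)

lemma bd_bd (c : SimplexChain (n + 2) X) : bd n X (bd (n + 1) X c) = 0 := by
  suffices h : bd n X ∘ₗ bd (n + 1) X = 0 from LinearMap.congr_fun h c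
  ext τ : 2
  simp only [LinearMap.comp_apply, Finsupp.lsingle_apply, LinearMap.zero_apply]
  rw [← realize_verts, bd_realize, bd_realize, TupleChain.bd_bd, map_zero]

/-- Barycentric subdivision of singular chains. -/
noncomputable def sd (n : ℕ) (X : Type) [TopologicalSpace X] :
    SimplexChain n X →ₗ[ℤ] SimplexChain n X :=
  Finsupp.linearCombination ℤ fun τ => realize τ (TupleChain.sd n n (verts n))

lemma sd_single (τ : C(TopSimplex n, X)) :
    sd n X (Finsupp.single τ 1) = realize τ (TupleChain.sd n n (verts n)) := by
  simp [sd]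

lemma sd_realize (τ : C(TopSimplex k, X)) (c : TupleChain n (TopSimplex k)) :
    sd n X (realize τ c) = realize τ (TupleChain.sd k n c) := by
  suffices h : sd n X ∘ₗ realize τ = realize τ ∘ₗ TupleChain.sd k n from LinearMap.congr_fun h c
  ext v : 2
  simp only [LinearMap.comp_apply, Finsupp.lsingle_apply, sd_single, realize_single]
  rw [← realize_map, TupleChain.map_sd, map_verts]

lemma bd_sd (c : SimplexChain (n + 1) X) : bd n X (sd (n + 1) X c) = sd n X (bd n X c) := by
  suffices h : bd n X ∘ₗ sd (n + 1) X = sd n X ∘ₗ bd n X from LinearMap.congr_fun h c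
  ext τ : 2
  simp only [LinearMap.comp_apply, Finsupp.lsingle_apply]
  rw [sd_single, bd_realize, TupleChain.bd_sd, ← sd_realize, ← bd_realize, realize_verts]

lemma push_sd (f : C(X, Y)) (c : SimplexChain n X) : push f (sd n X c) = sd n Y (push f c) := by
  suffices h : push f ∘ₗ sd n X = sd n Y ∘ₗ push f from LinearMap.congr_fun h c
  ext τ : 2
  simp only [LinearMap.comp_apply, Finsupp.lsingle_apply, sd_single, push_single, push_realize]

/-- A chain homotopy from the bottom of a homotopy to the subdivision of its top. -/
noncomputable def sdHomotopy (n : ℕ) (H : C(X × I, Y)) :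
    SimplexChain n X →ₗ[ℤ] SimplexChain (n + 1) Y :=
  Finsupp.linearCombination ℤ fun τ =>
    realizePrism (H.comp (τ.prodMap (ContinuousMap.id I))) (TupleChain.sdHomotopy n n (verts n))

lemma sdHomotopy_single (H : C(X × I, Y)) (τ : C(TopSimplex n, X)) :
    sdHomotopy n H (Finsupp.single τ 1) = realizePrism (H.comp (τ.prodMap (ContinuousMap.id I)))
      (TupleChain.sdHomotopy n n (verts n)) := by
  rw [sdHomotopy, Finsupp.linearCombination_single, one_smul]

lemma sdHomotopy_realize (H : C(X × I, Y)) (τ : C(TopSimplex k, X))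
    (c : TupleChain n (TopSimplex k)) :
    sdHomotopy n H (realize τ c) = realizePrism (H.comp (τ.prodMap (ContinuousMap.id I)))
      (TupleChain.sdHomotopy k n c) := by
  suffices h : sdHomotopy n H ∘ₗ realize τ =
    realizePrism (H.comp (τ.prodMap (ContinuousMap.id I))) ∘ₗ TupleChain.sdHomotopy k n from
    LinearMap.congr_fun h c
  ext v : 2
  simp only [LinearMap.comp_apply, Finsupp.lsingle_apply, sdHomotopy_single, realize_single]
  rw [← map_verts v, ← TupleChain.map_sdHomotopy, realizePrism_map]
  rfl

lemma bd_sdHomotopy_zero (H : C(X × I, Y)) (c : SimplexChain 0 X) :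
    bd 0 Y (sdHomotopy 0 H c) = push (H.comp (slice X 1)) (sd 0 X c)
      - push (H.comp (slice X 0)) c := by
  suffices h : bd 0 Y ∘ₗ sdHomotopy 0 H = push (H.comp (slice X 1)) ∘ₗ sd 0 X
    - push (H.comp (slice X 0)) from LinearMap.congr_fun h c
  ext τ : 2
  simp only [LinearMap.comp_apply, Finsupp.lsingle_apply, LinearMap.sub_apply]
  rw [sdHomotopy_single, bd_realizePrism, TupleChain.bd_sdHomotopy_zero, map_sub,
    realizePrism_map_slice, realizePrism_map_slice, realize_verts, sd_single, push_realize,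
    push_single]
  rfl

lemma bd_sdHomotopy_succ (H : C(X × I, Y)) (c : SimplexChain (n + 1) X) :
    bd (n + 1) Y (sdHomotopy (n + 1) H c) = push (H.comp (slice X 1)) (sd (n + 1) X c)
      - push (H.comp (slice X 0)) c - sdHomotopy n H (bd n X c) := by
  suffices h : bd (n + 1) Y ∘ₗ sdHomotopy (n + 1) H = push (H.comp (slice X 1)) ∘ₗ sd (n + 1) X
    - push (H.comp (slice X 0)) - sdHomotopy n H ∘ₗ bd n X from LinearMap.congr_fun h c
  ext τ : 2
  simp only [LinearMap.comp_apply, Finsupp.lsingle_apply, LinearMap.sub_apply]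
  rw [sdHomotopy_single, bd_realizePrism, TupleChain.bd_sdHomotopy_succ, map_sub, map_sub,
    realizePrism_map_slice, realizePrism_map_slice, realize_verts, sd_single, push_realize,
    push_single, ← sdHomotopy_realize, ← bd_realize, realize_verts]
  rfl

/-- Cycles of the augmented singular complex. -/
def IsCycle : ∀ {n : ℕ}, SimplexChain n X → Prop
  | 0, _ => True
  | n + 1, z => bd n X z = 0

lemma isCycle_bd (c : SimplexChain (n + 1) X) : IsCycle (bd n X c) := by
  cases n with
  | zero => trivial
  | succ n => exact bd_bd c

lemma IsCycle.push {z : SimplexChain n X} (hz : IsCycle z) (f : C(X, Y)) :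
    IsCycle (push f z) := by
  cases n with
  | zero => trivial
  | succ n => change bd n Y _ = 0; rw [← push_bd, show bd n X z = 0 from hz, map_zero]

lemma IsCycle.bd_sdHomotopy {z : SimplexChain n X} (hz : IsCycle z) (H : C(X × I, Y)) :
    bd n Y (sdHomotopy n H z) = SimplexChain.push (H.comp (slice X 1)) (sd n X z)
      - SimplexChain.push (H.comp (slice X 0)) z := by
  cases n with
  | zero => exact bd_sdHomotopy_zero H z
  | succ n => rw [bd_sdHomotopy_succ, show bd n X z = 0 from hz, map_zero, sub_zero]

/-- The chains all of whose simplices have image in `S`. -/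
def inside (n : ℕ) (S : Set X) : Submodule ℤ (SimplexChain n X) :=
  Finsupp.supported ℤ ℤ {τ | ∀ x, τ x ∈ S}

/-- The boundaries of the chains all of whose simplices have image in `S`. -/
noncomputable def bdInside (n : ℕ) (S : Set X) : Submodule ℤ (SimplexChain n X) :=
  (inside (n + 1) S).map (bd n X)

lemma single_mem_inside {S : Set X} {τ : C(TopSimplex n, X)} (h : ∀ x, τ x ∈ S) (a : ℤ) :
    Finsupp.single τ a ∈ inside n S :=
  Finsupp.single_mem_supported ℤ a h

lemma map_mem_of_mem_inside {M : Type*} [AddCommGroup M] {S : Set X}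
    (L : SimplexChain n X →ₗ[ℤ] M) (N : Submodule ℤ M) (h : ∀ τ : C(TopSimplex n, X),
      (∀ x, τ x ∈ S) → L (Finsupp.single τ 1) ∈ N) {c : SimplexChain n X} (hc : c ∈ inside n S) :
    L c ∈ N := by
  suffices h' : inside n S ≤ N.comap L from h' hc
  rw [inside, Finsupp.supported_eq_span_single, Submodule.span_le]
  rintro _ ⟨τ, hτ, rfl⟩
  exact h τ hτ

lemma inside_mono {S T : Set X} (h : S ⊆ T) : inside n S ≤ inside n T :=
  Finsupp.supported_mono fun _ hτ x => h (hτ x)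

lemma inside_univ : inside n (Set.univ : Set X) = ⊤ :=
  eq_top_iff.2 fun _ _ _ _ _ => trivial

lemma inside_inter {S T : Set X} {c : SimplexChain n X} (hS : c ∈ inside n S)
    (hT : c ∈ inside n T) : c ∈ inside n (S ∩ T) :=
  fun _ hτ x => ⟨hS hτ x, hT hτ x⟩

lemma realize_mem_inside {S : Set X} {τ : C(TopSimplex k, X)} (h : ∀ x, τ x ∈ S)
    (c : TupleChain n (TopSimplex k)) : realize τ c ∈ inside n S := by
  induction c using Finsupp.induction_linear with
  | zero => simp
  | add f g hf hg => rw [map_add]; exact add_mem hf hg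
  | single v a =>
    rw [realize, Finsupp.lmapDomain_apply, Finsupp.mapDomain_single]
    exact single_mem_inside (fun x => h (simplexComb v x)) a

lemma realizePrism_mem_inside {S : Set X} {H : C(TopSimplex k × I, X)} (h : ∀ x, H x ∈ S)
    (c : TupleChain n (TopSimplex k × I)) : realizePrism H c ∈ inside n S := by
  induction c using Finsupp.induction_linear with
  | zero => simp
  | add f g hf hg => rw [map_add]; exact add_mem hf hg
  | single v a =>
    rw [realizePrism, Finsupp.lmapDomain_apply, Finsupp.mapDomain_single]
    exact single_mem_inside (fun x => h (prismComb v x)) a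

lemma bd_mem_inside {S : Set X} {c : SimplexChain (n + 1) X} (hc : c ∈ inside (n + 1) S) :
    bd n X c ∈ inside n S := by
  refine map_mem_of_mem_inside (bd n X) _ (fun τ hτ => ?_) hc
  rw [← realize_verts, bd_realize]
  exact realize_mem_inside hτ _

lemma push_mem_inside {S : Set X} {T : Set Y} {f : C(X, Y)} (h : Set.MapsTo f S T)
    {c : SimplexChain n X} (hc : c ∈ inside n S) : push f c ∈ inside n T := by
  refine map_mem_of_mem_inside (push f) _ (fun τ hτ => ?_) hc
  rw [push_single]
  exact single_mem_inside (fun x => h (hτ x)) 1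

lemma sd_mem_inside {S : Set X} {c : SimplexChain n X} (hc : c ∈ inside n S) :
    sd n X c ∈ inside n S := by
  refine map_mem_of_mem_inside (sd n X) _ (fun τ hτ => ?_) hc
  rw [sd_single]
  exact realize_mem_inside hτ _

lemma sdHomotopy_mem_inside {S : Set X} {T : Set Y} {H : C(X × I, Y)}
    (h : ∀ x ∈ S, ∀ t, H (x, t) ∈ T) {c : SimplexChain n X} (hc : c ∈ inside n S) :
    sdHomotopy n H c ∈ inside (n + 1) T := by
  refine map_mem_of_mem_inside (sdHomotopy n H) _ (fun τ hτ => ?_) hc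
  rw [sdHomotopy_single]
  exact realizePrism_mem_inside (fun x => h _ (hτ _) _) _

lemma bdInside_mono {S T : Set X} (h : S ⊆ T) : bdInside n S ≤ bdInside n T :=
  Submodule.map_mono (inside_mono h)

lemma bd_mem_bdInside {S : Set X} {c : SimplexChain (n + 1) X} (hc : c ∈ inside (n + 1) S) :
    bd n X c ∈ bdInside n S :=
  Submodule.mem_map_of_mem hc

lemma isCycle_of_mem_bdInside {S : Set X} {z : SimplexChain n X} (hz : z ∈ bdInside n S) :
    IsCycle z := by
  obtain ⟨c, -, rfl⟩ := hz
  exact isCycle_bd c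

lemma push_mem_bdInside {S : Set X} {T : Set Y} {f : C(X, Y)} (h : Set.MapsTo f S T)
    {c : SimplexChain n X} (hc : c ∈ bdInside n S) : push f c ∈ bdInside n T := by
  obtain ⟨c, hc, rfl⟩ := hc
  rw [push_bd]
  exact bd_mem_bdInside (push_mem_inside h hc)

lemma IsCycle.sd_sub_mem {S : Set X} {z : SimplexChain n X} (hz : IsCycle z)
    (hzS : z ∈ inside n S) : sd n X z - z ∈ bdInside n S := by
  have h := hz.bd_sdHomotopy (ContinuousMap.fst : C(X × I, X))
  rw [show (ContinuousMap.fst : C(X × I, X)).comp (slice X 1) = ContinuousMap.id X from rfl,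
    show (ContinuousMap.fst : C(X × I, X)).comp (slice X 0) = ContinuousMap.id X from rfl,
    push_id, push_id] at h
  rw [← h]
  exact bd_mem_bdInside (sdHomotopy_mem_inside (fun x hx _ => hx) hzS)

/-- Homotopic maps have the same effect on cycles up to boundaries. -/
lemma IsCycle.push_sub_push_mem {S : Set X} {T : Set Y} {z : SimplexChain n X} (hz : IsCycle z)
    (hzS : z ∈ inside n S) (H : C(X × I, Y)) (h : ∀ x ∈ S, ∀ t, H (x, t) ∈ T) :
    SimplexChain.push (H.comp (slice X 1)) z - SimplexChain.push (H.comp (slice X 0)) z ∈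
      bdInside n T := by
  have h1 := bd_mem_bdInside (sdHomotopy_mem_inside h hzS)
  rw [hz.bd_sdHomotopy] at h1
  have h2 := push_mem_bdInside (T := T) (f := H.comp (slice X 1)) (fun x hx => h x hx 1)
    (hz.sd_sub_mem hzS)
  rw [map_sub] at h2
  have := sub_mem h1 h2
  convert this using 1
  abel

end SimplexChain

instance : IsEmpty (TopSimplex 0) :=
  ⟨fun x => zero_ne_one (Finset.sum_empty.symm.trans x.2.2)⟩

namespace TupleChain

variable {n k : ℕ}

lemma dist_tupleBary_le {v : Fin (n + 1) → TopSimplex k} {δ : ℝ}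
    (hv : ∀ i j, dist (v i) (v j) ≤ δ) (j : Fin (n + 1)) :
    dist (tupleBary v) (v j) ≤ (1 - ((n + 1 : ℕ) : ℝ)⁻¹) * δ := by
  have hn : (0 : ℝ) < (n : ℝ) + 1 := by positivity
  rw [Subtype.dist_eq, dist_eq_norm]
  have h1 : (tupleBary v).1 - (v j).1 =
      ((n : ℝ) + 1)⁻¹ • ∑ i ∈ Finset.univ.erase j, ((v i).1 - (v j).1) := by
    have h2 : (tupleBary v).1 = ∑ i, ((n : ℝ) + 1)⁻¹ • (v i).1 := by
      change ∑ i, (stdSimplex.barycenter : TopSimplex (n + 1)) i • (v i).1 = _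
      refine Finset.sum_congr rfl fun i _ => ?_
      change ((Fintype.card (Fin (n + 1)) : ℝ)⁻¹) • _ = _
      rw [Fintype.card_fin, Nat.cast_succ]
    rw [Finset.sum_erase _ (sub_self _), h2, Finset.sum_sub_distrib, smul_sub, Finset.smul_sum]
    congr 1
    rw [Finset.sum_const, Finset.card_univ, Fintype.card_fin, ← Nat.cast_smul_eq_nsmul ℝ,
      smul_smul]
    push_cast
    rw [inv_mul_cancel₀ hn.ne', one_smul]
  rw [h1, norm_smul, norm_inv, Real.norm_of_nonneg hn.le]
  have h3 : ‖∑ i ∈ Finset.univ.erase j, ((v i).1 - (v j).1)‖ ≤ n * δ := by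
    refine (norm_sum_le_of_le _ fun i _ => ?_).trans_eq (b := ∑ i ∈ Finset.univ.erase j, δ) ?_
    · rw [← dist_eq_norm, ← Subtype.dist_eq]
      exact hv i j
    · simp
  calc ((n : ℝ) + 1)⁻¹ * _ ≤ ((n : ℝ) + 1)⁻¹ * (n * δ) := by gcongr
    _ = _ := by push_cast; field_simp; ring

lemma sd_single_mem_supported (v : Fin n → TopSimplex k) {δ : ℝ} (hδ : 0 ≤ δ)
    (hv : ∀ i j, dist (v i) (v j) ≤ δ) {K : Set (Fin k → ℝ)} (hK : Convex ℝ K)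
    (hvK : ∀ i, (v i).1 ∈ K) :
    sd k n (Finsupp.single v 1) ∈ Finsupp.supported ℤ ℤ
      {w : Fin n → TopSimplex k | ∀ i, (w i).1 ∈ K ∧
        ∀ j, dist (w i) (w j) ≤ (1 - (n : ℝ)⁻¹) * δ} := by
  induction n generalizing K with
  | zero => exact Finsupp.single_mem_supported ℤ _ fun i => i.elim0
  | succ n ih =>
    set δ' := (1 - ((n + 1 : ℕ) : ℝ)⁻¹) * δ with hδ'
    have hδ'0 : 0 ≤ δ' := by
      refine mul_nonneg (sub_nonneg.2 (inv_le_one_of_one_le₀ ?_)) hδ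
      exact_mod_cast Nat.succ_pos n
    set b := tupleBary v with hb
    have hbK : b.1 ∈ K :=
      hK.sum_mem (fun i _ => (stdSimplex.barycenter : TopSimplex (n + 1)).2.1 i)
        (stdSimplex.barycenter : TopSimplex (n + 1)).2.2 (fun i _ => hvK i)
    have hface : sd k n (bd n _ (Finsupp.single v 1)) ∈ Finsupp.supported ℤ ℤ
        {w : Fin n → TopSimplex k | ∀ i, (w i).1 ∈ K ∩ Metric.closedBall b.1 δ' ∧
          ∀ j, dist (w i) (w j) ≤ (1 - (n : ℝ)⁻¹) * δ} := by
      rw [bd_single, map_sum]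
      refine Submodule.sum_mem _ fun i _ => ?_
      rw [map_smul]
      refine Submodule.smul_mem _ _ (ih _ (fun _ _ => hv _ _)
        (hK.inter (convex_closedBall _ _)) fun j => ⟨hvK _, ?_⟩)
      rw [Metric.mem_closedBall, dist_comm]
      exact dist_tupleBary_le hv _
    rw [sd_succ_single]
    rw [Finsupp.supported_eq_span_single] at hface
    refine Submodule.span_induction (p := fun c _ => cone b c ∈ _) ?_ ?_ ?_ ?_ hface
    · rintro _ ⟨w, hw, rfl⟩
      rw [cone_single]
      refine Finsupp.single_mem_supported ℤ _ fun i => ⟨?_, fun j => ?_⟩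
      · refine Fin.cases ?_ (fun i => ?_) i
        · exact hbK
        · exact (hw i).1.1
      · refine Fin.cases ?_ (fun i => ?_) i <;> refine Fin.cases ?_ (fun j => ?_) j
        · simpa using hδ'0
        · have := (hw j).1.2
          rw [Metric.mem_closedBall, dist_comm] at this
          exact this
        · exact (hw i).1.2
        · refine ((hw i).2 j).trans ?_
          have hn : 0 < (n : ℝ) := by exact_mod_cast i.pos
          simp only [hδ']
          gcongr
          simp
    · simp
    · intro x y _ _ hx hy
      rw [map_add]
      exact add_mem hx hy
    · intro a x _ hx
      rw [map_smul]
      exact Submodule.smul_mem _ _ hx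

lemma sd_pow_mem_supported (N : ℕ) (c : TupleChain n (TopSimplex k)) :
    (sd k n ^ N) c ∈ Finsupp.supported ℤ ℤ
      {w : Fin n → TopSimplex k | ∀ i j, dist (w i) (w j) ≤ (1 - (n : ℝ)⁻¹) ^ N} := by
  induction N with
  | zero =>
    refine fun w _ i j => ?_
    rw [Subtype.dist_eq, pow_zero, dist_pi_le_iff zero_le_one]
    intro l
    have h : ∀ i : Fin n, 0 ≤ (w i).1 l ∧ (w i).1 l ≤ 1 := fun i =>
      ⟨(w i).2.1 l, stdSimplex.le_one (w i) l⟩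
    rw [Real.dist_eq, abs_le]
    exact ⟨by linarith [(h i).1, (h j).2], by linarith [(h i).2, (h j).1]⟩
  | succ N ih =>
    rw [pow_succ' (sd k n), Module.End.mul_apply]
    rw [Finsupp.supported_eq_span_single] at ih
    refine Submodule.span_induction (p := fun c _ => sd k n c ∈ _) ?_ ?_ ?_ ?_ ih
    · rintro _ ⟨w, hw, rfl⟩
      rcases n with - | n
      · exact fun _ _ i => i.elim0
      have := sd_single_mem_supported w (hw 0 0 |> dist_nonneg.trans) hw convex_univ
        fun _ => trivial
      refine Finsupp.supported_mono ?_ this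
      intro u hu i j
      rw [pow_succ']
      exact (hu i).2 j
    · simp
    · intro x y _ _ hx hy
      rw [map_add]
      exact add_mem hx hy
    · intro a x _ hx
      rw [map_smul]
      exact Submodule.smul_mem _ _ hx

end TupleChain

namespace SimplexChain

variable {X : Type} [TopologicalSpace X] {n k : ℕ}

lemma sd_pow_realize (τ : C(TopSimplex k, X)) (N : ℕ) (c : TupleChain n (TopSimplex k)) :
    (sd n X ^ N) (realize τ c) = realize τ ((TupleChain.sd k n ^ N) c) := by
  induction N with
  | zero => rfl
  | succ N ih => simp only [pow_succ', Module.End.mul_apply, ih, sd_realize]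

lemma sd_pow_mem_inside {S : Set X} {c : SimplexChain n X} (hc : c ∈ inside n S) (N : ℕ) :
    (sd n X ^ N) c ∈ inside n S := by
  induction N with
  | zero => exact hc
  | succ N ih => rw [pow_succ', Module.End.mul_apply]; exact sd_mem_inside ih

lemma exists_sd_pow_single_mem {S O₁ O₂ : Set X} (h₁ : IsOpen O₁) (h₂ : IsOpen O₂)
    (hS : S ⊆ O₁ ∪ O₂) {τ : C(TopSimplex n, X)} (hτ : ∀ x, τ x ∈ S) :
    ∃ N, (sd n X ^ N) (Finsupp.single τ 1) ∈ inside n (S ∩ O₁) ⊔ inside n (S ∩ O₂) := by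
  rcases n with - | n
  · exact ⟨0, Submodule.mem_sup_left (single_mem_inside (fun x : TopSimplex 0 => isEmptyElim x) 1)⟩
  obtain ⟨δ, hδ, hleb⟩ := lebesgue_number_lemma_of_metric
    (s := (Set.univ : Set (TopSimplex (n + 1))))
    (c := fun b : Bool => τ ⁻¹' (if b then O₁ else O₂)) isCompact_univ
    (fun b => by cases b <;> simpa using IsOpen.preimage τ.continuous ‹_›)
    (fun x _ => by
      rcases hS (hτ x) with h | h
      · exact Set.mem_iUnion.2 ⟨true, by simpa using h⟩
      · exact Set.mem_iUnion.2 ⟨false, by simpa using h⟩)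
  have hq : (1 : ℝ) - ((n + 1 : ℕ) : ℝ)⁻¹ < 1 := by
    rw [sub_lt_self_iff]
    positivity
  obtain ⟨N, hN⟩ := exists_pow_lt_of_lt_one hδ hq
  refine ⟨N, ?_⟩
  rw [← realize_verts, sd_pow_realize]
  have hsm := TupleChain.sd_pow_mem_supported N (verts (n + 1))
  rw [Finsupp.supported_eq_span_single] at hsm
  refine Submodule.span_induction (p := fun c _ => realize τ c ∈ _) ?_ ?_ ?_ ?_ hsm
  · rintro _ ⟨w, hw, rfl⟩
    rw [realize_single]
    obtain ⟨b, hb⟩ := hleb (w 0) trivial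
    have hsub : ∀ x, simplexComb w x ∈ Metric.ball (w 0) δ := by
      intro x
      rw [Metric.mem_ball, Subtype.dist_eq]
      refine lt_of_le_of_lt ?_ hN
      rw [← Metric.mem_closedBall]
      refine (convex_closedBall _ _).sum_mem (fun i _ => x.2.1 i) x.2.2 fun i _ => ?_
      rw [Metric.mem_closedBall, ← Subtype.dist_eq]
      exact hw i 0
    cases b
    · have h : ∀ x, (τ.comp (simplexComb w)) x ∈ S ∩ O₂ := fun x =>
        ⟨hτ _, by simpa using hb (hsub x)⟩
      exact Submodule.mem_sup_right (single_mem_inside h 1)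
    · have h : ∀ x, (τ.comp (simplexComb w)) x ∈ S ∩ O₁ := fun x =>
        ⟨hτ _, by simpa using hb (hsub x)⟩
      exact Submodule.mem_sup_left (single_mem_inside h 1)
  · simp
  · intro x y _ _ hx hy
    rw [map_add]
    exact add_mem hx hy
  · intro a x _ hx
    rw [map_smul]
    exact Submodule.smul_mem _ _ hx

/-- Chains become small, with respect to a cover by two open sets, after subdivision. -/
lemma exists_sd_pow_mem {S O₁ O₂ : Set X} (h₁ : IsOpen O₁) (h₂ : IsOpen O₂)
    (hS : S ⊆ O₁ ∪ O₂) {c : SimplexChain n X} (hc : c ∈ inside n S) :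
    ∃ N, (sd n X ^ N) c ∈ inside n (S ∩ O₁) ⊔ inside n (S ∩ O₂) := by
  have hstable : ∀ (c : SimplexChain n X) (N M : ℕ), N ≤ M →
      (sd n X ^ N) c ∈ inside n (S ∩ O₁) ⊔ inside n (S ∩ O₂) →
      (sd n X ^ M) c ∈ inside n (S ∩ O₁) ⊔ inside n (S ∩ O₂) := by
    intro c N M hNM h
    obtain ⟨L, rfl⟩ := Nat.exists_eq_add_of_le' hNM
    rw [pow_add, Module.End.mul_apply]
    obtain ⟨a, ha, b, hb, hab⟩ := Submodule.mem_sup.1 h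
    rw [← hab, map_add]
    exact Submodule.add_mem_sup (sd_pow_mem_inside ha _) (sd_pow_mem_inside hb _)
  rw [inside, Finsupp.supported_eq_span_single] at hc
  refine Submodule.span_induction
    (p := fun c _ => ∃ N, (sd n X ^ N) c ∈ inside n (S ∩ O₁) ⊔ inside n (S ∩ O₂)) ?_ ?_ ?_ ?_ hc
  · rintro _ ⟨τ, hτ, rfl⟩
    exact exists_sd_pow_single_mem h₁ h₂ hS hτ
  · exact ⟨0, by simp⟩
  · rintro x y _ _ ⟨N, hx⟩ ⟨M, hy⟩
    refine ⟨max N M, ?_⟩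
    rw [map_add]
    exact add_mem (hstable _ _ _ (le_max_left _ _) hx) (hstable _ _ _ (le_max_right _ _) hy)
  · rintro a x _ ⟨N, hx⟩
    exact ⟨N, by rw [map_smul]; exact Submodule.smul_mem _ _ hx⟩

end SimplexChain

namespace SimplexChain

variable {X Y D D' : Type} [TopologicalSpace X] [TopologicalSpace Y] [TopologicalSpace D]
  [TopologicalSpace D'] {n : ℕ}

/-- The sum of the coefficients of a chain. -/
noncomputable def coeffSum (n : ℕ) (X : Type) [TopologicalSpace X] : SimplexChain n X →ₗ[ℤ] ℤ :=
  Finsupp.linearCombination ℤ fun _ => 1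

/-- The constant simplex, as a chain. -/
noncomputable def constChain (n : ℕ) (x : X) : SimplexChain n X :=
  Finsupp.single (ContinuousMap.const _ x) 1

lemma push_const (y : Y) (c : SimplexChain n X) :
    push (ContinuousMap.const X y) c = coeffSum n X c • constChain n y := by
  suffices h : push (ContinuousMap.const X y) =
    (coeffSum n X).smulRight (constChain n y) from LinearMap.congr_fun h c
  ext τ : 2
  simp only [LinearMap.comp_apply, Finsupp.lsingle_apply, push_single, LinearMap.smulRight_apply,
    coeffSum, Finsupp.linearCombination_single, one_smul]
  rfl

lemma bd_constChain_of_even (hn : Even n) (x : X) :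
    bd n X (constChain (n + 1) x) = constChain n x := by
  have h : ∀ i : Fin (n + 1), (ContinuousMap.const (TopSimplex (n + 1)) x).comp (face i) =
    ContinuousMap.const _ x := fun _ => rfl
  rw [constChain, bd_single]
  simp only [h]
  rw [← Finset.sum_smul, Fin.sum_neg_one_pow, if_neg (by simpa [Nat.even_add_one] using hn),
    one_smul]
  rfl

lemma constChain_mem_inside {S : Set X} {x : X} (hx : x ∈ S) : constChain n x ∈ inside n S :=
  single_mem_inside (fun _ => hx) 1

lemma constChain_ne_zero (x : X) : constChain n x ≠ 0 := by
  simp [constChain]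

lemma IsCycle.push_const_mem {z : SimplexChain n X} (hz : IsCycle z) {S : Set Y} {y : Y}
    (hy : y ∈ S) : SimplexChain.push (ContinuousMap.const X y) z ∈ bdInside n S := by
  rcases Nat.even_or_odd n with hn | hn
  · rw [push_const, ← bd_constChain_of_even hn]
    exact Submodule.smul_mem _ _ (bd_mem_bdInside (constChain_mem_inside hy))
  · obtain ⟨m, rfl⟩ : ∃ m, n = m + 1 := ⟨n - 1, by have := hn.pos; omega⟩
    have hm : Even m := by simpa [Nat.odd_add_one] using hn
    have h := push_bd (ContinuousMap.const X y) z
    rw [show bd m X z = 0 from hz, map_zero, push_const, map_smul, bd_constChain_of_even hm] at h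
    have h0 := (smul_eq_zero.1 h.symm).resolve_right (constChain_ne_zero y)
    rw [push_const, h0, zero_smul]
    exact zero_mem _

/-- Cycles in a subspace which contracts in itself are boundaries. -/
lemma IsCycle.mem_bdInside_of_contraction {S : Set X} {z : SimplexChain n X} (hz : IsCycle z)
    (hzS : z ∈ inside n S) (H : C(X × I, X)) (hHS : ∀ x ∈ S, ∀ t, H (x, t) ∈ S)
    (h0 : ∀ x, H (x, 0) = x) {x₀ : X} (h1 : ∀ x, H (x, 1) = x₀) (hx₀ : x₀ ∈ S) :
    z ∈ bdInside n S := by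
  have h := hz.push_sub_push_mem hzS H hHS
  rw [show H.comp (slice X 0) = ContinuousMap.id X from ContinuousMap.ext h0,
    show H.comp (slice X 1) = ContinuousMap.const X x₀ from ContinuousMap.ext h1, push_id] at h
  simpa using sub_mem (hz.push_const_mem hx₀) h

/-- The straight-line homotopy on `D × I` from the identity to the projection to a slice. -/
def slide (D : Type) [TopologicalSpace D] (c : I) : C((D × I) × I, D × I) where
  toFun p := (p.1.1, ⟨(1 - p.2 : ℝ) * p.1.2 + p.2 * c,
    convex_Icc (0 : ℝ) 1 p.1.2.2 c.2 (sub_nonneg.2 p.2.2.2) p.2.2.1 (by simp)⟩)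
  continuous_toFun := by fun_prop

lemma slide_zero (c : I) (p : D × I) : slide D c (p, 0) = p :=
  Prod.ext rfl (Subtype.ext (by simp [slide]))

lemma slide_one (c : I) (p : D × I) : slide D c (p, 1) = (p.1, c) :=
  Prod.ext rfl (Subtype.ext (by simp [slide]))

lemma slide_self (c : I) (x : D) (s : I) : slide D c ((x, c), s) = (x, c) :=
  Prod.ext rfl (Subtype.ext (by simp only [slide, ContinuousMap.coe_mk]; ring))

lemma slide_snd_ne_one {c : I} (hc : c ≠ 1) {p : D × I} (hp : p.2 ≠ 1) (s : I) :
    (slide D c (p, s)).2 ≠ 1 := by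
  have hc' : (c : ℝ) < 1 := unitInterval.lt_one_iff_ne_one.2 hc
  have hp' : (p.2 : ℝ) < 1 := unitInterval.lt_one_iff_ne_one.2 hp
  refine unitInterval.lt_one_iff_ne_one.1 (Subtype.coe_lt_coe.1 ?_)
  exact convex_Iio (1 : ℝ) hp' hc' (sub_nonneg.2 s.2.2) s.2.1 (by simp)

lemma slide_snd_ne_zero {c : I} (hc : c ≠ 0) {p : D × I} (hp : p.2 ≠ 0) (s : I) :
    (slide D c (p, s)).2 ≠ 0 := by
  have hc' : 0 < (c : ℝ) := unitInterval.pos_iff_ne_zero.2 hc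
  have hp' : 0 < (p.2 : ℝ) := unitInterval.pos_iff_ne_zero.2 hp
  refine unitInterval.pos_iff_ne_zero.1 (Subtype.coe_lt_coe.1 ?_)
  exact convex_Ioi (0 : ℝ) hp' hc' (sub_nonneg.2 s.2.2) s.2.1 (by simp)

/-- The boundary of the cylinder on a pair. -/
def cylBoundary {E : Type} (S : Set E) : Set (E × I) := {p | p.1 ∈ S ∨ p.2 = 0 ∨ p.2 = 1}

/-- The part of `cylBoundary S` below the top. -/
def lower {E : Type} (S : Set E) : Set (E × I) := cylBoundary S ∩ {p | p.2 ≠ 1}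

/-- The part of `cylBoundary S` above the bottom. -/
def upper {E : Type} (S : Set E) : Set (E × I) := cylBoundary S ∩ {p | p.2 ≠ 0}

/-- The part of `cylBoundary S` strictly between top and bottom. -/
def middle {E : Type} (S : Set E) : Set (E × I) := {p | p.1 ∈ S ∧ p.2 ≠ 0 ∧ p.2 ≠ 1}

/-- The midpoint of the unit interval. -/
noncomputable def half : I := ⟨1 / 2, by norm_num, by norm_num⟩

lemma half_ne_zero : half ≠ 0 := fun h => by
  have := congrArg Subtype.val h
  norm_num [half] at this

lemma half_ne_one : half ≠ 1 := fun h => by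
  have := congrArg Subtype.val h
  norm_num [half] at this

lemma lower_inter_upper_subset {E : Type} (S : Set E) : lower S ∩ upper S ⊆ middle S := by
  rintro p ⟨⟨h, h1⟩, -, h0⟩
  exact ⟨(h.resolve_right (by rintro (h | h); exacts [h0 h, h1 h])), h0, h1⟩

lemma middle_subset_lower {E : Type} (S : Set E) : middle S ⊆ lower S :=
  fun _ hp => ⟨Or.inl hp.1, hp.2.2⟩

lemma middle_subset_upper {E : Type} (S : Set E) : middle S ⊆ upper S :=
  fun _ hp => ⟨Or.inl hp.1, hp.2.1⟩

lemma lower_subset {E : Type} (S : Set E) : lower S ⊆ cylBoundary S := Set.inter_subset_left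

lemma upper_subset {E : Type} (S : Set E) : upper S ⊆ cylBoundary S := Set.inter_subset_left

lemma mapsTo_slice_middle (S : Set D) : Set.MapsTo (slice D half) S (middle S) :=
  fun _ hx => ⟨hx, half_ne_zero, half_ne_one⟩

lemma mapsTo_fst_middle (S : Set D) :
    Set.MapsTo (ContinuousMap.fst : C(D × I, D)) (middle S) S := fun _ hp => hp.1

/-- Cycles in a subspace of a cylinder on a contractible space which slides in itself to a slice
are boundaries. -/
lemma IsCycle.mem_bdInside_of_slide [ContractibleSpace D] {Z : Set (D × I)} {c : I}
    (hc : ∀ x : D, (x, c) ∈ Z) (hZ : ∀ p ∈ Z, ∀ s, slide D c (p, s) ∈ Z)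
    {z : SimplexChain n (D × I)} (hz : IsCycle z) (hzZ : z ∈ inside n Z) : z ∈ bdInside n Z := by
  obtain ⟨x₀, ⟨F⟩⟩ := id_nullhomotopic D
  have h := hz.push_sub_push_mem hzZ (slide D c) hZ
  rw [show (slide D c).comp (slice _ 0) = ContinuousMap.id _ from ContinuousMap.ext (slide_zero c),
    show (slide D c).comp (slice _ 1) = (slice D c).comp ContinuousMap.fst from
      ContinuousMap.ext (slide_one c), push_id, ← push_push] at h
  have h' : SimplexChain.push ContinuousMap.fst z ∈ bdInside n (Set.univ : Set D) := by
    refine (hz.push ContinuousMap.fst).mem_bdInside_of_contraction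
      (by rw [inside_univ]; trivial) (F.toContinuousMap.comp ContinuousMap.prodSwap)
      (fun _ _ _ => trivial) (fun x => ?_) (x₀ := x₀) (fun x => ?_) trivial
    · exact F.apply_zero x
    · exact F.apply_one x
  simpa using sub_mem (push_mem_bdInside (T := Z) (f := slice D c) (fun x _ => hc x) h') h

lemma IsCycle.mem_bdInside_lower [ContractibleSpace D] {S : Set D}
    {z : SimplexChain n (D × I)} (hz : IsCycle z) (hzS : z ∈ inside n (lower S)) :
    z ∈ bdInside n (lower S) := by
  refine hz.mem_bdInside_of_slide (c := 0) (fun x => (⟨Or.inr (Or.inl rfl), zero_ne_one⟩ :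
    (x, 0) ∈ lower S)) ?_ hzS
  rintro ⟨x, t⟩ ⟨h, h1⟩ s
  refine ⟨?_, slide_snd_ne_one zero_ne_one h1 s⟩
  rcases h with h | h | h
  · exact Or.inl h
  · obtain rfl : t = 0 := h
    rw [slide_self]
    exact Or.inr (Or.inl rfl)
  · exact absurd h h1

lemma IsCycle.mem_bdInside_upper [ContractibleSpace D] {S : Set D}
    {z : SimplexChain n (D × I)} (hz : IsCycle z) (hzS : z ∈ inside n (upper S)) :
    z ∈ bdInside n (upper S) := by
  refine hz.mem_bdInside_of_slide (c := 1) (fun x => (⟨Or.inr (Or.inr rfl), one_ne_zero⟩ :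
    (x, 1) ∈ upper S)) ?_ hzS
  rintro ⟨x, t⟩ ⟨h, h1⟩ s
  refine ⟨?_, slide_snd_ne_zero one_ne_zero h1 s⟩
  rcases h with h | h | h
  · exact Or.inl h
  · exact absurd h h1
  · obtain rfl : t = 1 := h
    rw [slide_self]
    exact Or.inr (Or.inr rfl)

lemma IsCycle.push_slice_sub_mem {S : Set D} {z : SimplexChain n (D × I)} (hz : IsCycle z)
    (hzS : z ∈ inside n (middle S)) :
    SimplexChain.push (slice D half) (SimplexChain.push ContinuousMap.fst z) - z ∈
      bdInside n (middle S) := by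
  have h := hz.push_sub_push_mem (T := middle S) hzS (slide D half) fun p hp s =>
    ⟨hp.1, slide_snd_ne_zero half_ne_zero hp.2.1 s, slide_snd_ne_one half_ne_one hp.2.2 s⟩
  rwa [show (slide D half).comp (slice _ 0) = ContinuousMap.id _ from
      ContinuousMap.ext (slide_zero half),
    show (slide D half).comp (slice _ 1) = (slice D half).comp ContinuousMap.fst from
      ContinuousMap.ext (slide_one half), push_id, ← push_push] at h

lemma IsCycle.sd_pow_sub_mem {S : Set X} {z : SimplexChain n X} (hz : IsCycle z)
    (hzS : z ∈ inside n S) (N : ℕ) : (sd n X ^ N) z - z ∈ bdInside n S := by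
  have hsd : ∀ {z : SimplexChain n X}, IsCycle z → IsCycle (sd n X z) := by
    intro z hz
    cases n with
    | zero => trivial
    | succ n => exact (bd_sd z).trans (by rw [show bd n X z = 0 from hz, map_zero])
  have hsdN : ∀ N, IsCycle ((sd n X ^ N) z) := by
    intro N
    induction N with
    | zero => exact hz
    | succ N ih => rw [pow_succ', Module.End.mul_apply]; exact hsd ih
  induction N with
  | zero => simp
  | succ N ih =>
    have := add_mem ((hsdN N).sd_sub_mem (sd_pow_mem_inside hzS N)) ih
    rw [pow_succ', Module.End.mul_apply]
    simpa using this

lemma bd_sd_pow (N : ℕ) (c : SimplexChain (n + 1) X) :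
    bd n X ((sd (n + 1) X ^ N) c) = (sd n X ^ N) (bd n X c) := by
  induction N with
  | zero => rfl
  | succ N ih => simp only [pow_succ', Module.End.mul_apply, bd_sd, ih]

lemma push_sd_pow (f : C(X, Y)) (N : ℕ) (c : SimplexChain n X) :
    push f ((sd n X ^ N) c) = (sd n Y ^ N) (push f c) := by
  induction N with
  | zero => rfl
  | succ N ih => simp only [pow_succ', Module.End.mul_apply, push_sd, ih]

lemma exists_sd_pow_mem_lower_sup_upper {S : Set D} {c : SimplexChain n (D × I)}
    (hc : c ∈ inside n (cylBoundary S)) :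
    ∃ N, ∃ a ∈ inside n (lower S), ∃ b ∈ inside n (upper S), a + b = (sd n (D × I) ^ N) c := by
  have h : ∀ t : I, IsOpen {p : D × I | p.2 ≠ t} := fun t =>
    isOpen_compl_singleton.preimage continuous_snd
  obtain ⟨N, hN⟩ := exists_sd_pow_mem (h 1) (h 0) (fun p _ => by
    by_cases hp : p.2 = 1
    · exact Or.inr (by simp [hp])
    · exact Or.inl hp) hc
  exact ⟨N, Submodule.mem_sup.1 hN⟩

lemma exists_bd_eq_push_slice [ContractibleSpace D] {S : Set D} {z : SimplexChain n D}
    (hz : IsCycle z) (hzS : z ∈ inside n S) :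
    ∃ a ∈ inside (n + 1) (lower S), ∃ b ∈ inside (n + 1) (upper S),
      bd n _ a = push (slice D half) z ∧ bd n _ b = - push (slice D half) z := by
  have h := push_mem_inside (mapsTo_slice_middle S) hzS
  obtain ⟨a, ha, ha'⟩ := (hz.push (slice D half)).mem_bdInside_lower
    (inside_mono (middle_subset_lower S) h)
  obtain ⟨b, hb, hb'⟩ := (hz.push (slice D half)).mem_bdInside_upper
    (inside_mono (middle_subset_upper S) h)
  exact ⟨a, ha, -b, neg_mem hb, ha', by rw [map_neg, hb']⟩

lemma bd_mem_inside_middle {S : Set D} {a b : SimplexChain (n + 1) (D × I)}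
    (ha : a ∈ inside (n + 1) (lower S)) (hb : b ∈ inside (n + 1) (upper S))
    (hab : IsCycle (a + b)) : bd n _ a ∈ inside n (middle S) := by
  refine inside_mono (lower_inter_upper_subset S) (inside_inter (bd_mem_inside ha) ?_)
  have : bd n _ a = - bd n _ b := eq_neg_of_add_eq_zero_left ((map_add _ _ _).symm.trans hab)
  rw [this]
  exact neg_mem (bd_mem_inside hb)

/-- The connecting homomorphism of the Mayer-Vietoris sequence of a cylinder boundary
is well defined. -/
lemma push_fst_bd_mem_bdInside {S : Set D} {a b : SimplexChain (n + 1) (D × I)}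
    (ha : a ∈ inside (n + 1) (lower S)) (hb : b ∈ inside (n + 1) (upper S))
    (hab : a + b ∈ bdInside (n + 1) (cylBoundary S)) :
    push ContinuousMap.fst (bd n _ a) ∈ bdInside n S := by
  have hcyc := bd_mem_inside_middle ha hb (isCycle_of_mem_bdInside hab)
  obtain ⟨w, hw, hwab⟩ := hab
  obtain ⟨N, u, hu, v, hv, huv⟩ := exists_sd_pow_mem_lower_sup_upper hw
  have hbd : bd (n + 1) _ u + bd (n + 1) _ v =
      (sd (n + 1) (D × I) ^ N) a + (sd (n + 1) (D × I) ^ N) b := by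
    rw [← map_add, huv, bd_sd_pow, hwab, map_add]
  have hc : (sd (n + 1) (D × I) ^ N) a - bd (n + 1) _ u ∈ inside (n + 1) (middle S) := by
    refine inside_mono (lower_inter_upper_subset S) (inside_inter
      (sub_mem (sd_pow_mem_inside ha N) (bd_mem_inside hu)) ?_)
    have : (sd (n + 1) (D × I) ^ N) a - bd (n + 1) _ u =
        bd (n + 1) _ v - (sd (n + 1) (D × I) ^ N) b := by
      rw [sub_eq_sub_iff_add_eq_add, ← hbd]; abel
    rw [this]
    exact sub_mem (bd_mem_inside hv) (sd_pow_mem_inside hb N)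
  have h1 := bd_mem_bdInside (push_mem_inside (mapsTo_fst_middle S) hc)
  rw [← push_bd, map_sub, bd_bd, sub_zero, bd_sd_pow, push_sd_pow] at h1
  have h2 := ((isCycle_bd a).push (ContinuousMap.fst : C(D × I, D))).sd_pow_sub_mem
    (push_mem_inside (mapsTo_fst_middle S) hcyc) N
  simpa using sub_mem h1 h2

/-- `f`, regarded as a map from the subspace `S` to the subspace `T`, induces a nonzero map
on reduced homology (in degree `n - 1`). -/
def Nontriv (n : ℕ) (f : C(X, Y)) (S : Set X) (T : Set Y) : Prop :=
  ∃ z ∈ inside n S, IsCycle z ∧ push f z ∉ bdInside n T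

/-- The reduced homology of `S` (in degree `n - 1`) is infinite cyclic. -/
def InfiniteCyclic (n : ℕ) (S : Set X) : Prop :=
  ∃ u ∈ inside n S, IsCycle u ∧
    (∀ z ∈ inside n S, IsCycle z → ∃ k : ℤ, z - k • u ∈ bdInside n S) ∧
    ∀ k : ℤ, k • u ∈ bdInside n S → k = 0

lemma Nontriv.cylinder [ContractibleSpace D] {h : C(D, D')} {S : Set D} {S' : Set D'}
    (hS : Set.MapsTo h S S') (H : Nontriv n h S S') :
    Nontriv (n + 1) (h.prodMap (ContinuousMap.id I)) (cylBoundary S) (cylBoundary S') := by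
  obtain ⟨z, hzS, hz, hne⟩ := H
  obtain ⟨a, ha, b, hb, hza, hzb⟩ := exists_bd_eq_push_slice hz hzS
  refine ⟨a + b, add_mem (inside_mono (lower_subset S) ha) (inside_mono (upper_subset S) hb),
    (map_add _ _ _).trans (by rw [hza, hzb, add_neg_cancel]), fun hmem => hne ?_⟩
  rw [map_add] at hmem
  have hcyl : Set.MapsTo (h.prodMap (ContinuousMap.id I)) (cylBoundary S) (cylBoundary S') :=
    fun p hp => hp.imp (fun hp => hS hp) id
  have := push_fst_bd_mem_bdInside
    (push_mem_inside (T := lower S') (fun p hp => ⟨hcyl hp.1, hp.2⟩) ha)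
    (push_mem_inside (T := upper S') (fun p hp => ⟨hcyl hp.1, hp.2⟩) hb) hmem
  rwa [← push_bd, hza, push_push, push_push] at this

lemma InfiniteCyclic.cylinder [ContractibleSpace D] {S : Set D} (H : InfiniteCyclic n S) :
    InfiniteCyclic (n + 1) (cylBoundary S) := by
  obtain ⟨u, huS, hu, hgen, htor⟩ := H
  obtain ⟨a, ha, b, hb, hua, hub⟩ := exists_bd_eq_push_slice hu huS
  refine ⟨a + b, add_mem (inside_mono (lower_subset S) ha) (inside_mono (upper_subset S) hb),
    (map_add _ _ _).trans (by rw [hua, hub, add_neg_cancel]), fun z hzS hz => ?_, fun k hk => ?_⟩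
  · obtain ⟨N, v, hv, w, hw, hvw⟩ := exists_sd_pow_mem_lower_sup_upper hzS
    have hsub := hz.sd_pow_sub_mem hzS N
    have hbdvw : bd n _ v + bd n _ w = 0 := by
      rw [← map_add, hvw, bd_sd_pow, show bd n _ z = 0 from hz, map_zero]
    have hmid := bd_mem_inside_middle hv hw ((map_add _ _ _).trans hbdvw)
    obtain ⟨k, hk⟩ := hgen _ (push_mem_inside (mapsTo_fst_middle S) hmid)
      ((isCycle_bd v).push _)
    have h1 := push_mem_bdInside (mapsTo_slice_middle S) hk
    have h2 := (isCycle_bd v).push_slice_sub_mem hmid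
    obtain ⟨q, hq, hqeq⟩ := sub_mem h1 h2
    rw [map_sub, map_smul, ← hua] at hqeq
    have hqeq' : bd n _ q = bd n _ v - k • bd n _ a := by rw [hqeq]; abel
    refine ⟨k, ?_⟩
    have hl : v - k • a - q ∈ bdInside (n + 1) (lower S) := by
      refine IsCycle.mem_bdInside_lower ?_ (sub_mem (sub_mem hv (Submodule.smul_mem _ _ ha))
        (inside_mono (middle_subset_lower S) hq))
      change bd n _ _ = 0
      rw [map_sub, map_sub, map_smul, hqeq', sub_self]
    have hr : w - k • b + q ∈ bdInside (n + 1) (upper S) := by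
      refine IsCycle.mem_bdInside_upper ?_ (add_mem (sub_mem hw (Submodule.smul_mem _ _ hb))
        (inside_mono (middle_subset_upper S) hq))
      change bd n _ _ = 0
      rw [map_add, map_sub, map_smul, hqeq', hub, ← hua, eq_neg_of_add_eq_zero_right hbdvw,
        smul_neg]
      abel
    have := sub_mem (add_mem (bdInside_mono (lower_subset S) hl)
      (bdInside_mono (upper_subset S) hr)) hsub
    convert this using 1
    rw [← hvw, smul_add]
    abel
  · rw [smul_add] at hk
    have := push_fst_bd_mem_bdInside (Submodule.smul_mem _ k ha) (Submodule.smul_mem _ k hb) hk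
    rw [map_smul, hua, map_smul, push_push] at this
    exact htor k (by rwa [show (ContinuousMap.fst : C(D × I, D)).comp (slice D half) =
      ContinuousMap.id D from rfl, push_id] at this)

end SimplexChain

namespace SimplexChain

variable {X Y X' Y' : Type} [TopologicalSpace X] [TopologicalSpace Y] [TopologicalSpace X']
  [TopologicalSpace Y'] {n : ℕ}

lemma Nontriv.of_factor {f : C(X, Y)} {f' : C(X', Y')} {S : Set X} {S' : Set X'} {T : Set Y}
    {T' : Set Y'} (H : Nontriv n f S T) (a : C(X, X')) (b : C(Y', Y))
    (ha : Set.MapsTo a S S') (hb : Set.MapsTo b T' T) (h : ∀ x, b (f' (a x)) = f x) :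
    Nontriv n f' S' T' := by
  obtain ⟨z, hzS, hz, hne⟩ := H
  refine ⟨push a z, push_mem_inside ha hzS, hz.push a, fun hmem => hne ?_⟩
  have := push_mem_bdInside hb hmem
  rwa [push_push, push_push, show (b.comp f').comp a = f from ContinuousMap.ext h] at this

lemma InfiniteCyclic.of_homeomorph {S : Set X} {T : Set Y} (H : InfiniteCyclic n S) (e : X ≃ₜ Y)
    (h : ∀ x, e x ∈ T ↔ x ∈ S) : InfiniteCyclic n T := by
  have h1 : Set.MapsTo (e : C(X, Y)) S T := fun x hx => (h x).2 hx
  have h2 : Set.MapsTo (e.symm : C(Y, X)) T S := fun y hy => (h _).1 (by simpa using hy)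
  have h12 : ∀ z : SimplexChain n Y, push (e : C(X, Y)) (push (e.symm : C(Y, X)) z) = z :=
    fun z => by
      rw [push_push, show (e : C(X, Y)).comp (e.symm : C(Y, X)) = ContinuousMap.id Y from
        ContinuousMap.ext e.apply_symm_apply, push_id]
  have h21 : ∀ z : SimplexChain n X, push (e.symm : C(Y, X)) (push (e : C(X, Y)) z) = z :=
    fun z => by
      rw [push_push, show (e.symm : C(Y, X)).comp (e : C(X, Y)) = ContinuousMap.id X from
        ContinuousMap.ext e.symm_apply_apply, push_id]
  obtain ⟨u, huS, hu, hgen, htor⟩ := H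
  refine ⟨push (e : C(X, Y)) u, push_mem_inside h1 huS, hu.push _, fun z hzS hz => ?_,
    fun k hk => htor k ?_⟩
  · obtain ⟨k, hk⟩ := hgen _ (push_mem_inside h2 hzS) (hz.push _)
    have := push_mem_bdInside h1 hk
    rw [map_sub, h12, map_smul] at this
    exact ⟨k, this⟩
  · have := push_mem_bdInside h2 hk
    rwa [map_smul, h21] at this

/-- Maps which are nontrivial on homology compose to such a map
if the homology groups in question are infinite cyclic. -/
lemma Nontriv.comp {f : C(X, Y)} {g : C(Y, X')} {S : Set X} {T : Set Y} {R : Set X'}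
    (hg : Nontriv n g T R) (hf : Nontriv n f S T) (hfS : Set.MapsTo f S T)
    (hgT : Set.MapsTo g T R) (hT : InfiniteCyclic n T) (hR : InfiniteCyclic n R) :
    Nontriv n (g.comp f) S R := by
  obtain ⟨u, huT, hu, hugen, -⟩ := hT
  obtain ⟨r, hrR, hr, hrgen, hrtor⟩ := hR
  obtain ⟨z, hzS, hz, hzne⟩ := hf
  obtain ⟨w, hwT, hw, hwne⟩ := hg
  obtain ⟨k, hk⟩ := hugen _ (push_mem_inside hfS hzS) (hz.push f)
  obtain ⟨l, hl⟩ := hugen _ hwT hw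
  obtain ⟨m, hm⟩ := hrgen _ (push_mem_inside hgT huT) (hu.push g)
  have hk0 : k ≠ 0 := by
    rintro rfl
    exact hzne (by simpa using hk)
  have hm0 : m ≠ 0 := by
    rintro rfl
    rw [zero_smul, sub_zero] at hm
    have h := push_mem_bdInside hgT hl
    rw [map_sub, map_smul] at h
    exact hwne (by simpa using add_mem h (Submodule.smul_mem _ l hm))
  refine ⟨z, hzS, hz, fun hmem => mul_ne_zero hk0 hm0 (hrtor _ ?_)⟩
  have h := push_mem_bdInside hgT hk
  rw [map_sub, map_smul, push_push] at h
  have h' := sub_mem (sub_mem hmem h) (Submodule.smul_mem _ k hm)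
  convert h' using 1
  rw [smul_sub, smul_smul]
  abel

/-- The boundary of a product of pairs. -/
def prodBoundary {X Y : Type} (S : Set X) (T : Set Y) : Set (X × Y) := {p | p.1 ∈ S ∨ p.2 ∈ T}

/-- The boundary of the unit cube. -/
def cubeBoundary (d : ℕ) : Set (Fin d → I) := {x | ∃ i, x i = 0 ∨ x i = 1}

lemma cubeBoundary_zero : cubeBoundary 0 = ∅ :=
  Set.eq_empty_of_forall_notMem fun _ ⟨i, _⟩ => i.elim0

lemma cons_mem_cubeBoundary {d : ℕ} (t : I) (x : Fin d → I) :
    (Fin.cons t x : Fin (d + 1) → I) ∈ cubeBoundary (d + 1) ↔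
      x ∈ cubeBoundary d ∨ t = 0 ∨ t = 1 := by
  simp [cubeBoundary, Fin.exists_fin_succ, or_comm]

/-- Splitting off the first coordinate of a cube. -/
def prodCubeHomeomorph (X : Type) [TopologicalSpace X] (d : ℕ) :
    (X × (Fin d → I)) × I ≃ₜ X × (Fin (d + 1) → I) where
  toFun p := (p.1.1, Fin.cons p.2 p.1.2)
  invFun p := ((p.1, Fin.tail p.2), p.2 0)
  left_inv p := by simp
  right_inv p := by simp
  continuous_toFun := by fun_prop
  continuous_invFun := by unfold Fin.tail; fun_prop

lemma prodCubeHomeomorph_mem {S : Set X} {d : ℕ} (p : (X × (Fin d → I)) × I) :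
    prodCubeHomeomorph X d p ∈ prodBoundary S (cubeBoundary (d + 1)) ↔
      p ∈ cylBoundary (prodBoundary S (cubeBoundary d)) :=
  (or_congr_right (cons_mem_cubeBoundary p.2 p.1.2)).trans or_assoc.symm

lemma contractibleSpace_cube (d : ℕ) : ContractibleSpace (Fin d → I) := by
  induction d with
  | zero => infer_instance
  | succ d ih =>
    have : ContractibleSpace I := (convex_Icc (0 : ℝ) 1).contractibleSpace ⟨0, by simp⟩
    have := (prodCubeHomeomorph PUnit d).symm.contractibleSpace
    exact (Homeomorph.uniqueProd PUnit (Fin (d + 1) → I)).symm.contractibleSpace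

lemma Nontriv.prod_cube [ContractibleSpace X] {f : C(X, Y)} {S : Set X} {T : Set Y}
    (hST : Set.MapsTo f S T) (H : Nontriv n f S T) (d : ℕ) :
    Nontriv (n + d) (f.prodMap (ContinuousMap.id (Fin d → I)))
      (prodBoundary S (cubeBoundary d)) (prodBoundary T (cubeBoundary d)) := by
  induction d with
  | zero =>
    refine H.of_factor ((ContinuousMap.id X).prodMk (ContinuousMap.const X default))
      ContinuousMap.fst (fun x hx => Or.inl hx) (fun y hy => ?_) (fun x => rfl)
    exact hy.resolve_right (by simp [cubeBoundary_zero])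
  | succ d ih =>
    have := contractibleSpace_cube d
    refine (ih.cylinder fun p hp => hp.imp (fun h => hST h) id).of_factor
      (prodCubeHomeomorph X d : C(_, _)) ((prodCubeHomeomorph Y d).symm : C(_, _))
      (fun p hp => (prodCubeHomeomorph_mem p).2 hp) (fun p hp => ?_) (fun p => ?_)
    · exact (prodCubeHomeomorph_mem _).1 (by simpa using hp)
    · exact (Homeomorph.symm_apply_eq _).2 rfl

lemma InfiniteCyclic.prod_cube [ContractibleSpace X] {S : Set X}
    (H : InfiniteCyclic n S) (d : ℕ) :
    InfiniteCyclic (n + d) (prodBoundary S (cubeBoundary d)) := by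
  induction d with
  | zero =>
    refine H.of_homeomorph (Homeomorph.prodUnique X (Fin 0 → I)).symm fun x => ?_
    simp only [prodBoundary, cubeBoundary_zero, Set.mem_empty_iff_false, or_false]
    exact Iff.rfl
  | succ d ih =>
    have := contractibleSpace_cube d
    exact ih.cylinder.of_homeomorph (prodCubeHomeomorph X d) prodCubeHomeomorph_mem

lemma bdInside_empty : bdInside 0 (∅ : Set X) = ⊥ := by
  have : inside 1 (∅ : Set X) = ⊥ := by
    rw [inside, show {τ : C(TopSimplex 1, X) | ∀ x, τ x ∈ (∅ : Set X)} = ∅ from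
      Set.eq_empty_of_forall_notMem fun τ hτ => hτ (stdSimplex.vertex 0), Finsupp.supported_empty]
  rw [bdInside, this, Submodule.map_bot]

lemma infiniteCyclic_empty [Nonempty X] : InfiniteCyclic 0 (∅ : Set X) := by
  obtain ⟨x₀⟩ := ‹Nonempty X›
  have hsub : Subsingleton C(TopSimplex 0, X) := ⟨fun f g => ContinuousMap.ext isEmptyElim⟩
  refine ⟨constChain 0 x₀, single_mem_inside (fun x : TopSimplex 0 => isEmptyElim x) 1, trivial,
    fun z _ _ => ⟨z (ContinuousMap.const _ x₀), ?_⟩, fun k hk => ?_⟩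
  · rw [bdInside_empty, Submodule.mem_bot, sub_eq_zero]
    ext τ
    simp [constChain, Subsingleton.elim τ (ContinuousMap.const _ x₀)]
  · rw [bdInside_empty, Submodule.mem_bot] at hk
    exact (smul_eq_zero.1 hk).resolve_right (constChain_ne_zero x₀)

lemma nontriv_empty [Nonempty X] (f : C(X, Y)) : Nontriv 0 f ∅ ∅ := by
  obtain ⟨x₀⟩ := ‹Nonempty X›
  refine ⟨constChain 0 x₀, single_mem_inside (fun x : TopSimplex 0 => isEmptyElim x) 1, trivial, ?_⟩
  rw [bdInside_empty, Submodule.mem_bot, constChain, push_single]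
  exact constChain_ne_zero (f x₀)

end SimplexChain

/-- The unit cube in Euclidean space. -/
def euclideanCube (d : ℕ) : Set (EuclideanSpace ℝ (Fin d)) := {x | ∀ i, x i ∈ Set.Icc (0 : ℝ) 1}

lemma euclideanCube_eq (d : ℕ) : euclideanCube d =
    PiLp.homeomorph 2 (fun _ : Fin d => ℝ) ⁻¹' Set.pi Set.univ fun _ => Set.Icc 0 1 := by
  ext x
  exact ⟨fun h i _ => h i, fun h i => h i trivial⟩

lemma isCompact_euclideanCube (d : ℕ) : IsCompact (euclideanCube d) := by
  rw [euclideanCube_eq, Homeomorph.isCompact_preimage]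
  exact isCompact_univ_pi fun _ => isCompact_Icc

lemma interior_euclideanCube (d : ℕ) :
    interior (euclideanCube d) = {x | ∀ i, x i ∈ Set.Ioo (0 : ℝ) 1} := by
  rw [euclideanCube_eq, ← Homeomorph.preimage_interior, interior_pi_set Set.finite_univ]
  ext x
  simp [PiLp.homeomorph, Set.mem_pi]

lemma convex_euclideanCube (d : ℕ) : Convex ℝ (euclideanCube d) :=
  fun _ hx _ hy _ _ ha hb hab i => convex_Icc (0 : ℝ) 1 (hx i) (hy i) ha hb hab

/-- The cube as a subspace of Euclidean space. -/
def euclideanCubeHomeomorph (d : ℕ) : euclideanCube d ≃ₜ (Fin d → I) where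
  toFun x i := ⟨x.1 i, x.2 i⟩
  invFun y := ⟨WithLp.toLp 2 fun i => (y i : ℝ), fun i => (y i).2⟩
  left_inv x := rfl
  right_inv y := rfl
  continuous_toFun := by fun_prop
  continuous_invFun := by fun_prop

lemma exists_homeomorph_unitBall_cube (d : ℕ) : ∃ e : unitBall d ≃ₜ (Fin d → I),
    ∀ x, e x ∈ SimplexChain.cubeBoundary d ↔ ‖(x : EuclideanSpace ℝ (Fin d))‖ = 1 := by
  obtain ⟨e, -, h1, h2⟩ := exists_homeomorph_image_eq
    (convex_closedBall (0 : EuclideanSpace ℝ (Fin d)) 1)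
    (by rw [interior_closedBall _ one_ne_zero]; exact ⟨0, by simp⟩)
    (NormedSpace.isVonNBounded_closedBall ℝ _ 1) (convex_euclideanCube d)
    (by
      rw [interior_euclideanCube]
      exact ⟨WithLp.toLp 2 fun _ => 1 / 2, fun i => by norm_num⟩)
    (NormedSpace.isVonNBounded_of_isBounded ℝ (isCompact_euclideanCube d).isBounded)
  rw [Metric.isClosed_closedBall.closure_eq, (isCompact_euclideanCube d).isClosed.closure_eq] at h1
  have hmem : ∀ x, x ∈ unitBall d ↔ e x ∈ euclideanCube d := fun x => by
    rw [← h1, e.injective.mem_set_image]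
  rw [frontier_closedBall _ one_ne_zero, (isCompact_euclideanCube d).isClosed.frontier_eq,
    interior_euclideanCube] at h2
  refine ⟨(e.subtype hmem).trans (euclideanCubeHomeomorph d), fun x => ?_⟩
  have hx : e x ∈ euclideanCube d := (hmem x).1 x.2
  rw [← mem_sphere_zero_iff_norm, ← e.injective.mem_set_image, h2, Set.mem_sdiff, and_iff_right hx,
    Set.mem_ofPred_eq, not_forall]
  refine exists_congr fun i => ?_
  have hxi := hx i
  change ((⟨e x i, hxi⟩ : I) = 0 ∨ (⟨e x i, hxi⟩ : I) = 1) ↔ _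
  rw [Subtype.ext_iff, Subtype.ext_iff]
  change (e x i = 0 ∨ e x i = 1) ↔ ¬ (0 < e x i ∧ e x i < 1)
  rw [not_and_or, not_lt, not_lt]
  exact or_congr (le_antisymm_iff.trans (and_iff_left hxi.1)).symm.symm
    (le_antisymm_iff.trans (and_iff_right hxi.2))

lemma BallStructure.exists_homeomorph_cube {d : ℕ} {D : Type} [TopologicalSpace D]
    (B : BallStructure d D) :
    ∃ e : D ≃ₜ (Fin d → I), ∀ x, e x ∈ SimplexChain.cubeBoundary d ↔ x ∈ B.boundary := by
  obtain ⟨e, he⟩ := exists_homeomorph_unitBall_cube d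
  refine ⟨B.φ.symm.trans e, fun x => (he _).trans ?_⟩
  rw [BallStructure.boundary, Homeomorph.image_eq_preimage_symm]
  rfl

lemma BallStructure.contractibleSpace {d : ℕ} {D : Type} [TopologicalSpace D]
    (B : BallStructure d D) : ContractibleSpace D := by
  have := Metric.contractibleSpace_closedBall (x := (0 : EuclideanSpace ℝ (Fin d))) zero_le_one
  exact B.φ.symm.contractibleSpace

namespace SimplexChain

variable {X Y D : Type} [TopologicalSpace X] [TopologicalSpace Y] [TopologicalSpace D] {n d : ℕ}

lemma Nontriv.prod_ball [ContractibleSpace X] {f : C(X, Y)} {S : Set X} {T : Set Y}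
    (H : Nontriv n f S T) (hST : Set.MapsTo f S T) (B : BallStructure d D) :
    Nontriv (n + d) (f.prodMap (ContinuousMap.id D))
      (prodBoundary S B.boundary) (prodBoundary T B.boundary) := by
  obtain ⟨e, he⟩ := B.exists_homeomorph_cube
  refine (H.prod_cube hST d).of_factor
    ((ContinuousMap.id X).prodMap (e.symm : C(Fin d → I, D)))
    ((ContinuousMap.id Y).prodMap (e : C(D, Fin d → I)))
    (fun p hp => hp.imp id fun h => ?_) (fun p hp => hp.imp id fun h => (he _).2 h)
    (fun p => Prod.ext rfl (e.apply_symm_apply p.2))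
  exact (he _).1 (by simpa using h)

lemma InfiniteCyclic.prod_ball [ContractibleSpace X] {S : Set X} (H : InfiniteCyclic n S)
    (B : BallStructure d D) : InfiniteCyclic (n + d) (prodBoundary S B.boundary) := by
  obtain ⟨e, he⟩ := B.exists_homeomorph_cube
  refine (H.prod_cube d).of_homeomorph ((Homeomorph.refl X).prodCongr e.symm) fun p =>
    or_congr Iff.rfl ?_
  rw [← he]
  exact iff_of_eq (congrArg (· ∈ cubeBoundary d) (e.apply_symm_apply p.2))

lemma infiniteCyclic_boundary (B : BallStructure d D) : InfiniteCyclic d B.boundary := by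
  have h := (infiniteCyclic_empty (X := PUnit)).prod_ball B
  rw [zero_add] at h
  exact h.of_homeomorph (Homeomorph.uniqueProd PUnit D) fun p => (or_iff_right id).symm

end SimplexChain

open SimplexChain in
/-- The product of maps of balls which are nontrivial on the homology of the boundary. -/
lemma BallStructure.nontriv_prodMap {d e : ℕ} {D₁ D₂ D₃ D₄ : Type}
    [TopologicalSpace D₁] [TopologicalSpace D₂] [TopologicalSpace D₃] [TopologicalSpace D₄]
    (B₁ : BallStructure d D₁) (B₂ : BallStructure d D₂)
    (B₃ : BallStructure e D₃) (B₄ : BallStructure e D₄) {h : C(D₁, D₂)} {g : C(D₃, D₄)}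
    (hh : Nontriv d h B₁.boundary B₂.boundary) (hg : Nontriv e g B₃.boundary B₄.boundary)
    (hh' : Set.MapsTo h B₁.boundary B₂.boundary) (hg' : Set.MapsTo g B₃.boundary B₄.boundary) :
    Nontriv (d + e) (h.prodMap g) (prodBoundary B₁.boundary B₃.boundary)
      (prodBoundary B₂.boundary B₄.boundary) := by
  have := B₁.contractibleSpace
  have := B₂.contractibleSpace
  have := B₃.contractibleSpace
  have hg₁ : Nontriv (d + e) ((ContinuousMap.id D₁).prodMap g)
      (prodBoundary B₁.boundary B₃.boundary) (prodBoundary B₁.boundary B₄.boundary) := by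
    have := hg.prod_ball hg' B₁
    rw [add_comm e d] at this
    exact this.of_factor (ContinuousMap.prodSwap : C(D₃ × D₁, D₁ × D₃))
      (ContinuousMap.prodSwap : C(D₁ × D₄, D₄ × D₁)) (fun p hp => hp.symm)
      (fun p hp => hp.symm) (fun p => rfl)
  have hh₁ := hh.prod_ball hh' B₄
  have hfac : h.prodMap g = (h.prodMap (ContinuousMap.id D₄)).comp
      ((ContinuousMap.id D₁).prodMap g) := ContinuousMap.ext fun p => rfl
  rw [hfac]
  exact hh₁.comp hg₁ (fun p hp => hp.imp id fun h => hg' h)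
    (fun p hp => hp.imp (fun h => hh' h) id) ((infiniteCyclic_boundary B₁).prod_ball B₄)
    ((infiniteCyclic_boundary B₂).prod_ball B₄)

open Opposite Simplicial

namespace SimplexChain

variable {X Y : Type} [TopologicalSpace X] [TopologicalSpace Y] {n : ℕ}

/-- The comparison of chains of simplices with the singular chain complex. -/
noncomputable def toSingular (n : ℕ) (X : Type) [TopologicalSpace X] :
    SimplexChain (n + 1) X ≃ₗ[ℤ] ((singularChains.obj (TopCat.of X)).X n) :=
  Finsupp.domLCongr ((TopCat.of X).toSSetObjEquiv (op ⦋n⦌)).symm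

lemma toSingular_single (τ : C(TopSimplex (n + 1), X)) :
    toSingular n X (Finsupp.single τ 1) =
      ModuleCat.freeMk (R := ℤ) (((TopCat.of X).toSSetObjEquiv (op ⦋n⦌)).symm τ) :=
  Finsupp.domLCongr_single _ _ _

lemma simplexMap_succAbove (i : Fin (n + 2)) (x : TopSimplex (n + 1)) :
    stdSimplex.map (i.succAbove) x = face i x := by
  apply Subtype.ext
  funext j
  change FunOnFinite.linearMap ℝ ℝ i.succAbove x j =
    (∑ k, x k • (stdSimplex.vertex (i.succAbove k) : TopSimplex (n + 2)).1) j
  rw [FunOnFinite.linearMap_apply_apply, Finset.sum_filter, Finset.sum_apply]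
  refine Finset.sum_congr rfl fun k _ => ?_
  change _ = x k * (Pi.single (i.succAbove k) 1 : Fin (n + 2) → ℝ) j
  rw [Pi.single_apply, mul_ite, mul_one, mul_zero]
  simp only [eq_comm]

lemma toSSetObjEquiv_symm_δ (i : Fin (n + 2)) (τ : C(TopSimplex (n + 2), X)) :
    (TopCat.toSSet.obj (TopCat.of X)).δ i
      (((TopCat.of X).toSSetObjEquiv (op ⦋n + 1⦌)).symm τ) =
      ((TopCat.of X).toSSetObjEquiv (op ⦋n⦌)).symm (τ.comp (face i)) := by
  have : τ.comp (face i) = τ.comp ⟨stdSimplex.map (i.succAbove), stdSimplex.continuous_map _⟩ :=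
    ContinuousMap.ext fun x => congrArg τ (simplexMap_succAbove i x).symm
  rw [this]
  rfl

lemma toSingular_push (f : C(X, Y)) (c : SimplexChain (n + 1) X) :
    toSingular n Y (push f c) =
      (singularChains.map (TopCat.ofHom f)).f n (toSingular n X c) := by
  suffices h : (toSingular n Y).toLinearMap ∘ₗ push f =
      ((singularChains.map (TopCat.ofHom f)).f n).hom ∘ₗ (toSingular n X).toLinearMap from
    LinearMap.congr_fun h c
  ext τ : 2
  simp only [LinearMap.comp_apply, Finsupp.lsingle_apply, push_single, LinearEquiv.coe_coe,
    toSingular_single]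
  exact (ModuleCat.free_map_apply (R := ℤ) ((TopCat.toSSet.map (TopCat.ofHom f)).app (op ⦋n⦌))
    (((TopCat.of X).toSSetObjEquiv (op ⦋n⦌)).symm τ)).symm

lemma free_alternating_apply {m : ℕ} {A B : Type} (f : Fin m → (A ⟶ B)) (x : A) :
    (∑ i : Fin m, (-1 : ℤ) ^ (i : ℕ) • (ModuleCat.free ℤ).map (f i)) (ModuleCat.freeMk x) =
      ∑ i : Fin m, (-1 : ℤ) ^ (i : ℕ) • ModuleCat.freeMk (R := ℤ) (f i x) := by
  refine (DFunLike.congr_fun (ModuleCat.hom_sum _ _) _).trans ?_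
  rw [LinearMap.sum_apply]
  refine Finset.sum_congr rfl fun i _ => ?_
  rw [ModuleCat.hom_zsmul]
  exact congrArg (fun y => (-1 : ℤ) ^ (i : ℕ) • y) (ModuleCat.free_map_apply (f i) x)

lemma toSingular_bd (c : SimplexChain (n + 2) X) :
    toSingular n X (bd (n + 1) X c) =
      (singularChains.obj (TopCat.of X)).d (n + 1) n (toSingular (n + 1) X c) := by
  suffices h : (toSingular n X).toLinearMap ∘ₗ bd (n + 1) X =
      ((singularChains.obj (TopCat.of X)).d (n + 1) n).hom ∘ₗ
        (toSingular (n + 1) X).toLinearMap from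
    LinearMap.congr_fun h c
  ext τ : 2
  simp only [LinearMap.comp_apply, Finsupp.lsingle_apply, LinearEquiv.coe_coe,
    toSingular_single, bd_single, map_sum]
  have hd : (singularChains.obj (TopCat.of X)).d (n + 1) n =
      ∑ i : Fin (n + 2), (-1 : ℤ) ^ (i : ℕ) •
        (ModuleCat.free ℤ).map ((TopCat.toSSet.obj (TopCat.of X)).δ i) :=
    AlgebraicTopology.alternatingFaceMapComplex_obj_d _ _
  rw [hd]
  refine Eq.trans ?_ (free_alternating_apply _ _).symm
  refine Finset.sum_congr rfl fun i _ => ?_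
  rw [map_smul, toSingular_single, ← toSSetObjEquiv_symm_δ]
  rfl

end SimplexChain

namespace HomologicalComplex

variable (K : ChainComplex (ModuleCat.{0} ℤ) ℕ) (n : ℕ)

lemma exists_homologyπ_eq (x : K.homology n) : ∃ c : K.cycles n, K.homologyπ n c = x :=
  (ModuleCat.epi_iff_surjective (K.homologyπ n)).1 inferInstance x

lemma exists_iCycles_eq (z : K.X n) :
    (∃ c : K.cycles n, K.iCycles n c = z) ↔ ∀ j, K.d n j z = 0 := by
  constructor
  · rintro ⟨c, rfl⟩ j
    exact ConcreteCategory.congr_hom (K.iCycles_d n j) c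
  · intro h
    have := (ShortComplex.moduleCat_exact_iff _).1
      (ShortComplex.exact_of_f_is_kernel (.mk _ _ (K.iCycles_d n _)) (K.cyclesIsKernel n _ rfl))
    exact this z (h _)

lemma homologyπ_eq_zero_iff (c : K.cycles n) :
    K.homologyπ n c = 0 ↔ ∃ w : K.X (n + 1), K.d (n + 1) n w = K.iCycles n c := by
  have h : ∀ w, K.iCycles n (K.toCycles (n + 1) n w) = K.d (n + 1) n w := fun w =>
    ConcreteCategory.congr_hom (K.toCycles_i (n + 1) n) w
  constructor
  · intro hc
    have := (ShortComplex.moduleCat_exact_iff _).1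
      (ShortComplex.exact_of_g_is_cokernel (.mk _ _ (K.toCycles_comp_homologyπ (n + 1) n))
        (K.homologyIsCokernel (n + 1) n (by simp)))
    obtain ⟨w, rfl⟩ := this c hc
    exact ⟨w, (h w).symm⟩
  · rintro ⟨w, hw⟩
    rw [← h] at hw
    rw [← (ModuleCat.mono_iff_injective (K.iCycles n)).1 inferInstance hw]
    exact ConcreteCategory.congr_hom (K.toCycles_comp_homologyπ (n + 1) n) w

end HomologicalComplex

namespace SimplexChain

variable {X Y : Type} [TopologicalSpace X] [TopologicalSpace Y] {n : ℕ}

lemma SHmap_homologyπ_eq_zero_iff (f : C(X, Y)) {z : SimplexChain (n + 1) X}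
    {c : (singularChains.obj (TopCat.of X)).cycles n}
    (hc : (singularChains.obj (TopCat.of X)).iCycles n c = toSingular n X z) :
    SHmap n f ((singularChains.obj (TopCat.of X)).homologyπ n c) = 0 ↔
      push f z ∈ bdInside (n + 1) Set.univ := by
  have h1 : SHmap n f ((singularChains.obj (TopCat.of X)).homologyπ n c) =
      (singularChains.obj (TopCat.of Y)).homologyπ n
        (HomologicalComplex.cyclesMap (singularChains.map (TopCat.ofHom f)) n c) :=
    ConcreteCategory.congr_hom
      (HomologicalComplex.homologyπ_naturality (singularChains.map (TopCat.ofHom f)) n) c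
  have h2 : (singularChains.obj (TopCat.of Y)).iCycles n
      (HomologicalComplex.cyclesMap (singularChains.map (TopCat.ofHom f)) n c) =
      toSingular n Y (push f z) := by
    rw [toSingular_push, ← hc]
    exact ConcreteCategory.congr_hom
      (HomologicalComplex.cyclesMap_i (singularChains.map (TopCat.ofHom f)) n) c
  rw [h1]
  refine (HomologicalComplex.homologyπ_eq_zero_iff _ _ _).trans ?_
  rw [h2, bdInside, inside_univ]
  constructor
  · rintro ⟨w, hw⟩
    obtain ⟨w, rfl⟩ := (toSingular (n + 1) Y).surjective w
    rw [← toSingular_bd] at hw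
    exact ⟨w, trivial, (toSingular n Y).injective hw⟩
  · rintro ⟨w, -, hw⟩
    exact ⟨toSingular (n + 1) Y w, by rw [← toSingular_bd, hw]⟩

lemma exists_iCycles_eq_toSingular {z : SimplexChain (n + 1) X} (hz : IsCycle z) :
    ∃ c, (singularChains.obj (TopCat.of X)).iCycles n c = toSingular n X z := by
  refine (HomologicalComplex.exists_iCycles_eq _ _ _).2 fun j => ?_
  by_cases hj : j + 1 = n
  · subst hj
    rw [← toSingular_bd, show bd (j + 1) X z = 0 from hz, map_zero]
  · rw [HomologicalComplex.shape _ _ _ hj]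
    rfl

lemma isCycle_of_iCycles_eq_toSingular {z : SimplexChain (n + 1) X}
    {c : (singularChains.obj (TopCat.of X)).cycles n}
    (hc : (singularChains.obj (TopCat.of X)).iCycles n c = toSingular n X z)
    (h : push (ContinuousMap.const X (PUnit.unit : PUnit.{1})) z ∈ bdInside (n + 1) Set.univ) :
    IsCycle z := by
  cases n with
  | zero =>
    obtain ⟨w, -, hw⟩ := h
    have hinj : Function.Injective
        (push (n := 0) (ContinuousMap.const X (PUnit.unit : PUnit.{1}))) :=
      Finsupp.mapDomain_injective fun _ _ _ => ContinuousMap.ext isEmptyElim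
    refine hinj ?_
    rw [push_bd, ← hw, bd_bd, map_zero]
  | succ n =>
    have := (HomologicalComplex.exists_iCycles_eq _ _ _).1 ⟨c, hc⟩ n
    rw [← toSingular_bd] at this
    exact (toSingular n X).map_eq_zero_iff.1 this

lemma sHmapNontrivial_iff (f : C(X, Y)) :
    SHmapNontrivial n f ↔ Nontriv (n + 1) f Set.univ Set.univ := by
  constructor
  · rintro ⟨x, hx, hne⟩
    obtain ⟨c, rfl⟩ := HomologicalComplex.exists_homologyπ_eq _ _ x
    obtain ⟨z, hz⟩ := (toSingular n X).surjective
      ((singularChains.obj (TopCat.of X)).iCycles n c)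
    refine ⟨z, by rw [inside_univ]; trivial, isCycle_of_iCycles_eq_toSingular hz.symm ?_,
      fun h => hne ?_⟩
    · exact (SHmap_homologyπ_eq_zero_iff _ hz.symm).1 hx
    · exact (SHmap_homologyπ_eq_zero_iff _ hz.symm).2 h
  · rintro ⟨z, -, hz, hne⟩
    obtain ⟨c, hc⟩ := exists_iCycles_eq_toSingular hz
    refine ⟨(singularChains.obj (TopCat.of X)).homologyπ n c, ?_, fun h => hne ?_⟩
    · exact (SHmap_homologyπ_eq_zero_iff _ hc).2 (hz.push_const_mem trivial)
    · exact (SHmap_homologyπ_eq_zero_iff _ hc).1 h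

/-- The inclusion of a subspace. -/
def subtypeVal (S : Set X) : C(S, X) := ⟨Subtype.val, continuous_subtype_val⟩

lemma push_subtypeVal_injective (S : Set X) :
    Function.Injective (push (n := n) (subtypeVal S)) :=
  Finsupp.mapDomain_injective fun _ _ h =>
    ContinuousMap.ext fun x => Subtype.ext (ContinuousMap.congr_fun h x)

lemma push_subtypeVal_mem (S : Set X) (c : SimplexChain n S) :
    push (subtypeVal S) c ∈ inside n S :=
  push_mem_inside (S := Set.univ) (fun x _ => x.2) (by rw [inside_univ]; trivial)

lemma exists_push_subtypeVal {S : Set X} {c : SimplexChain n X} (hc : c ∈ inside n S) :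
    ∃ c', push (subtypeVal S) c' = c := by
  refine map_mem_of_mem_inside LinearMap.id (LinearMap.range (push (subtypeVal S)))
    (fun τ hτ => ?_) hc
  exact ⟨Finsupp.single ⟨fun x => ⟨τ x, hτ x⟩, τ.continuous.subtype_mk hτ⟩ 1, push_single _ _⟩

lemma isCycle_push_subtypeVal {S : Set X} {c : SimplexChain n S} :
    IsCycle (push (subtypeVal S) c) ↔ IsCycle c := by
  cases n with
  | zero => exact Iff.rfl
  | succ n =>
    refine ⟨fun h => push_subtypeVal_injective S ?_, fun h => h.push _⟩
    rw [push_bd, map_zero]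
    exact h

lemma push_subtypeVal_mem_bdInside {S : Set X} {c : SimplexChain n S} :
    push (subtypeVal S) c ∈ bdInside n S ↔ c ∈ bdInside n Set.univ := by
  refine ⟨?_, push_mem_bdInside fun x _ => x.2⟩
  rintro ⟨w, hw, h⟩
  obtain ⟨w, rfl⟩ := exists_push_subtypeVal hw
  rw [← push_bd] at h
  rw [← push_subtypeVal_injective S h]
  exact bd_mem_bdInside (by rw [inside_univ]; trivial)

lemma nontriv_restrictCM_iff (f : C(X, Y)) {S : Set X} {T : Set Y} (h : Set.MapsTo f S T) :
    Nontriv n (restrictCM f h) Set.univ Set.univ ↔ Nontriv n f S T := by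
  have hpush : ∀ z : SimplexChain n S, push (subtypeVal T) (push (restrictCM f h) z) =
      push f (push (subtypeVal S) z) := fun z => by
    rw [push_push, push_push]
    rfl
  constructor
  · rintro ⟨z, -, hz, hne⟩
    refine ⟨push (subtypeVal S) z, push_subtypeVal_mem S z, hz.push _, ?_⟩
    rwa [← hpush, push_subtypeVal_mem_bdInside]
  · rintro ⟨z, hzS, hz, hne⟩
    obtain ⟨z, rfl⟩ := exists_push_subtypeVal hzS
    rw [← hpush, push_subtypeVal_mem_bdInside] at hne
    exact ⟨z, by rw [inside_univ]; trivial, isCycle_push_subtypeVal.1 hz, hne⟩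

lemma sHmapNontrivial_restrictCM_iff (f : C(X, Y)) {S : Set X} {T : Set Y}
    (h : Set.MapsTo f S T) : SHmapNontrivial n (restrictCM f h) ↔ Nontriv (n + 1) f S T :=
  (sHmapNontrivial_iff _).trans (nontriv_restrictCM_iff f h)

end SimplexChain

lemma BallStructure.boundary_zero {D : Type} [TopologicalSpace D] (B : BallStructure 0 D) :
    B.boundary = ∅ := by
  rw [BallStructure.boundary, Set.image_eq_empty]
  refine Set.eq_empty_of_forall_notMem fun x hx => zero_ne_one ((norm_eq_zero.2 ?_).symm.trans hx)
  exact Subsingleton.elim _ _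

lemma dNontrivial_iff {d : ℕ} {D₁ D₂ : Type} [TopologicalSpace D₁] [TopologicalSpace D₂]
    (B₁ : BallStructure d D₁) (B₂ : BallStructure d D₂) (h : C(D₁, D₂)) :
    DNontrivial d B₁ B₂ h ↔ Set.MapsTo h B₁.boundary B₂.boundary ∧
      SimplexChain.Nontriv d h B₁.boundary B₂.boundary := by
  cases d with
  | zero =>
    refine iff_of_true (Or.inl rfl) ?_
    have := B₁.contractibleSpace
    rw [B₁.boundary_zero, B₂.boundary_zero]
    exact ⟨Set.mapsTo_empty _ _, SimplexChain.nontriv_empty h⟩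
  | succ d =>
    constructor
    · rintro (h0 | ⟨-, hb, H⟩)
      · exact absurd h0 d.succ_ne_zero
      · exact ⟨hb, (SimplexChain.sHmapNontrivial_restrictCM_iff h hb).1 H⟩
    · rintro ⟨hb, H⟩
      exact Or.inr ⟨d.succ_pos, hb, (SimplexChain.sHmapNontrivial_restrictCM_iff h hb).2 H⟩

/-- If `h : D₁ → D₂` is a continuous `d`-nontrivial map and `g : D₃ → D₄` is a
continuous `e`-nontrivial map, then the product map `h × g : D₁ × D₃ → D₂ × D₄` is
`(d+e)`-nontrivial with respect to the product ball structures, i.e. with respect to any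
`(d+e)`-ball structures on the products whose boundary is
`(∂D₁ × D₃) ∪ (D₁ × ∂D₃)` (resp. `(∂D₂ × D₄) ∪ (D₂ × ∂D₄)`).  (Note that when `e = 0` one has
`∂D₃ = ∅`, so that this set is `∂D₁ × D₃`, and similarly when `d = 0`.) -/
theorem dNontrivial_prod (d e : ℕ) (D₁ D₂ D₃ D₄ : Type)
    [TopologicalSpace D₁] [TopologicalSpace D₂] [TopologicalSpace D₃] [TopologicalSpace D₄]
    [CompactSpace D₁] [CompactSpace D₂] [CompactSpace D₃] [CompactSpace D₄]
    (B₁ : BallStructure d D₁) (B₂ : BallStructure d D₂)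
    (B₃ : BallStructure e D₃) (B₄ : BallStructure e D₄)
    (B₁₃ : BallStructure (d + e) (D₁ × D₃)) (B₂₄ : BallStructure (d + e) (D₂ × D₄))
    (hb₁₃ : B₁₃.boundary = (B₁.boundary ×ˢ (Set.univ : Set D₃)) ∪
      ((Set.univ : Set D₁) ×ˢ B₃.boundary))
    (hb₂₄ : B₂₄.boundary = (B₂.boundary ×ˢ (Set.univ : Set D₄)) ∪
      ((Set.univ : Set D₂) ×ˢ B₄.boundary))
    (h : C(D₁, D₂)) (g : C(D₃, D₄))
    (hh : DNontrivial d B₁ B₂ h) (hg : DNontrivial e B₃ B₄ g) :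
    DNontrivial (d + e) B₁₃ B₂₄ (h.prodMap g) := by
  obtain ⟨hh', hh⟩ := (dNontrivial_iff B₁ B₂ h).1 hh
  obtain ⟨hg', hg⟩ := (dNontrivial_iff B₃ B₄ g).1 hg
  have h₁₃ : B₁₃.boundary = SimplexChain.prodBoundary B₁.boundary B₃.boundary := by
    ext p
    simp [hb₁₃, SimplexChain.prodBoundary]
  have h₂₄ : B₂₄.boundary = SimplexChain.prodBoundary B₂.boundary B₄.boundary := by
    ext p
    simp [hb₂₄, SimplexChain.prodBoundary]
  rw [dNontrivial_iff, h₁₃, h₂₄]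
  exact ⟨fun p hp => hp.imp (fun hp => hh' hp) fun hp => hg' hp,
    BallStructure.nontriv_prodMap B₁ B₂ B₃ B₄ hh hg hh' hg'⟩
end
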